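/- arXiv:1111.4796 — 7 statements merged into one kernel-verified Lean document; each statement's English description precedes it below -/
import Mathlib

section
/- (Lemma 4.6, equal-h case) There is an absolute constant c > 0 with the following property. Let θ > 0, and let h, n₁, n₂ be positive integers with n₁ > θh, n₂ > θh and 0 < |α(θ; h, h, n₁, n₂)| < (1/10)·β(θ; h, h, n₁, n₂)^{1/4}. Then |α(θ; h, h, n₁, n₂)| ≥ c·h^{1/2}/(n₁n₂)^{1/4}. -/
/-- `α(θ; h₁,h₂,n₁,n₂) := √(h₁(2n₁ − θh₁)) − √(h₂(2n₂ − θh₂))`. -/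
noncomputable def alphaQ (θ : ℝ) (h₁ h₂ n₁ n₂ : ℕ) : ℝ :=
  Real.sqrt ((h₁ : ℝ) * (2 * n₁ - θ * h₁)) - Real.sqrt ((h₂ : ℝ) * (2 * n₂ - θ * h₂))

/-- `β(θ; h₁,h₂,n₁,n₂) := h₁(2n₁ − θh₁)·h₂(2n₂ − θh₂)`. -/
noncomputable def betaQ (θ : ℝ) (h₁ h₂ n₁ n₂ : ℕ) : ℝ :=
  ((h₁ : ℝ) * (2 * n₁ - θ * h₁)) * ((h₂ : ℝ) * (2 * n₂ - θ * h₂))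

/-- Lemma 4.6, equal-`h` case: there is an absolute constant `c > 0` such that for every
`θ > 0` and positive integers `h, n₁, n₂` with `n₁ > θh`, `n₂ > θh` and
`0 < |α(θ; h, h, n₁, n₂)| < (1/10)·β(θ; h, h, n₁, n₂)^{1/4}`, one has
`|α(θ; h, h, n₁, n₂)| ≥ c·h^{1/2}/(n₁n₂)^{1/4}`. -/
theorem lemma_4_6_equal :
    ∃ c : ℝ, 0 < c ∧ ∀ θ : ℝ, 0 < θ → ∀ h n₁ n₂ : ℕ,
      0 < h → 0 < n₁ → 0 < n₂ →
      θ * h < (n₁ : ℝ) → θ * h < (n₂ : ℝ) →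
      0 < |alphaQ θ h h n₁ n₂| →
      |alphaQ θ h h n₁ n₂| < (1 / 10) * (betaQ θ h h n₁ n₂) ^ ((1 : ℝ) / 4) →
      |alphaQ θ h h n₁ n₂| ≥ c * (h : ℝ) ^ ((1 : ℝ) / 2) / ((n₁ : ℝ) * n₂) ^ ((1 : ℝ) / 4) := by
  refine ⟨1 / 2, by norm_num, fun θ hθ h n₁ n₂ hh hn₁ hn₂ h₁ h₂ hpos hlt => ?_⟩
  have hh' : (0 : ℝ) < h := by exact_mod_cast hh
  have hn₁' : (0 : ℝ) < n₁ := by exact_mod_cast hn₁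
  have hn₂' : (0 : ℝ) < n₂ := by exact_mod_cast hn₂
  have hθh : 0 < θ * h := by positivity
  have hne : n₁ ≠ n₂ := by
    rintro rfl
    simp [alphaQ] at hpos
  have hdiff : (1 : ℝ) ≤ |(n₁ : ℝ) - n₂| := by
    have : (1 : ℤ) ≤ |(n₁ : ℤ) - n₂| := Int.one_le_abs (sub_ne_zero.2 (by exact_mod_cast hne))
    exact_mod_cast this
  have ha : 0 < (h : ℝ) * (2 * n₁ - θ * h) := mul_pos hh' (by linarith)
  have hb : 0 < (h : ℝ) * (2 * n₂ - θ * h) := mul_pos hh' (by linarith)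
  have hquarter : ∀ x : ℝ, 0 ≤ x → (x ^ ((1 : ℝ) / 4)) ^ 4 = x := fun x hx => by
    rw [← Real.rpow_natCast, ← Real.rpow_mul hx]; norm_num
  have hβ : betaQ θ h h n₁ n₂ ≤ 4 * h ^ 2 * (n₁ * n₂) := by
    have ha' : (h : ℝ) * (2 * n₁ - θ * h) ≤ h * (2 * n₁) := by gcongr; linarith
    have hb' : (h : ℝ) * (2 * n₂ - θ * h) ≤ h * (2 * n₂) := by gcongr; linarith
    calc betaQ θ h h n₁ n₂ ≤ (h * (2 * n₁)) * (h * (2 * n₂)) := by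
          unfold betaQ; exact mul_le_mul ha' hb' hb.le (by positivity)
      _ = _ := by ring
  have hβ0 : 0 < betaQ θ h h n₁ n₂ := mul_pos ha hb
  have ht4 := hquarter _ hβ0.le
  have hq4 := hquarter ((n₁ : ℝ) * n₂) (by positivity)
  have hq : 0 < ((n₁ : ℝ) * n₂) ^ ((1 : ℝ) / 4) := by positivity
  have ht : 0 < betaQ θ h h n₁ n₂ ^ ((1 : ℝ) / 4) := by positivity
  have hs : 0 < (h : ℝ) ^ ((1 : ℝ) / 2) := by positivity
  have hs2 : ((h : ℝ) ^ ((1 : ℝ) / 2)) ^ 2 = h := by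
    rw [← Real.rpow_natCast, ← Real.rpow_mul hh'.le]; norm_num
  have hA := Real.sqrt_pos.2 ha
  have hB := Real.sqrt_pos.2 hb
  have hA2 := Real.sq_sqrt ha.le
  have hB2 := Real.sq_sqrt hb.le
  have hβAB : betaQ θ h h n₁ n₂ = (√((h : ℝ) * (2 * n₁ - θ * h)) *
      √((h : ℝ) * (2 * n₂ - θ * h))) ^ 2 := by
    rw [mul_pow, hA2, hB2, betaQ]
  have hα : alphaQ θ h h n₁ n₂ = √((h : ℝ) * (2 * n₁ - θ * h)) -
      √((h : ℝ) * (2 * n₂ - θ * h)) := rfl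
  generalize √((h : ℝ) * (2 * n₁ - θ * h)) = A at *
  generalize √((h : ℝ) * (2 * n₂ - θ * h)) = B at *
  generalize betaQ θ h h n₁ n₂ ^ ((1 : ℝ) / 4) = t at *
  generalize ((n₁ : ℝ) * n₂) ^ ((1 : ℝ) / 4) = q at *
  generalize (h : ℝ) ^ ((1 : ℝ) / 2) = s at *
  have ht2 : t ^ 2 = A * B := by
    refine (pow_left_inj₀ (by positivity) (by positivity) two_ne_zero).1 ?_
    rw [← hβAB, ← ht4]; ring
  have htsq : t ^ 2 ≤ 2 * (s * q) ^ 2 := by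
    refine (pow_le_pow_iff_left₀ (by positivity) (by positivity) two_ne_zero).1 ?_
    calc (t ^ 2) ^ 2 = t ^ 4 := by ring
      _ ≤ 4 * (h : ℝ) ^ 2 * (n₁ * n₂) := ht4.trans_le hβ
      _ = (2 * (s * q) ^ 2) ^ 2 := by rw [← hs2, ← hq4]; ring
  have hα2 : (A - B) ^ 2 ≤ (1 / 10 * t) ^ 2 := by
    rw [← hα, ← sq_abs]
    exact pow_le_pow_left₀ hpos.le hlt.le 2
  have hsum : A + B ≤ 4 * (s * q) := by
    refine (pow_le_pow_iff_left₀ (by positivity) (by positivity) two_ne_zero).1 ?_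
    nlinarith [sq_nonneg (s * q)]
  have hprod : 2 * s ^ 2 ≤ |alphaQ θ h h n₁ n₂| * (A + B) := by
    calc 2 * s ^ 2 ≤ 2 * h * |(n₁ : ℝ) - n₂| := by rw [hs2]; nlinarith
      _ = |2 * h * ((n₁ : ℝ) - n₂)| := by rw [abs_mul, abs_of_pos (by positivity : (0 : ℝ) < 2 * h)]
      _ = |(A - B) * (A + B)| := by congr 1; linear_combination hB2 - hA2
      _ = |alphaQ θ h h n₁ n₂| * (A + B) := by
          rw [abs_mul, hα, abs_of_pos (by positivity : 0 < A + B)]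
  rw [ge_iff_le, div_le_iff₀ hq]
  refine le_of_mul_le_mul_left ?_ (by positivity : 0 < 4 * s)
  calc 4 * s * (1 / 2 * s) = 2 * s ^ 2 := by ring
    _ ≤ |alphaQ θ h h n₁ n₂| * (A + B) := hprod
    _ ≤ |alphaQ θ h h n₁ n₂| * (4 * (s * q)) := by gcongr
    _ = _ := by ring
end

section
/- (Kloosterman-type sum, bound for Σ₆) There is an absolute constant C > 0 such that for all reals H₁, H₂ with 2 ≤ H₁ ≤ H₂: Σ_{H₁ < h₁ ≤ 2H₁} Σ_{1 ≤ h ≤ H₁} (1/h) · Σ_{H₂ < h₂ ≤ 2H₂, h₁ ∤ h·h₂} 1/‖h·h₂/h₁‖ ≤ C·H₁·H₂·log²(2H₁). -/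
open Finset

/-- `‖t‖`, the distance from `t` to the nearest integer. -/
noncomputable def dnint (t : ℝ) : ℝ := |t - round t|

/-- `1 / ‖m / q‖` is at most the sum of its two candidate values `q / r` and `q / (q - r)`,
where `r` is the residue of `m` modulo `q`. -/
lemma one_div_dnint_natCast_div_le {m q : ℕ} (hq : 0 < q) (hm : ¬ q ∣ m) :
    1 / dnint ((m : ℝ) / q) ≤
      (q : ℝ) * (1 / ((m % q : ℕ) : ℝ) + 1 / ((q : ℝ) - (m % q : ℕ))) := by
  have hr : 0 < m % q := Nat.emod_pos_of_not_dvd hm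
  have hrq : m % q < q := Nat.mod_lt _ hq
  have hq' : (0 : ℝ) < q := by exact_mod_cast hq
  have hr' : (0 : ℝ) < (m % q : ℕ) := by exact_mod_cast hr
  have hrq' : (0 : ℝ) < (q : ℝ) - (m % q : ℕ) := sub_pos.2 (by exact_mod_cast hrq)
  have h₁ : 0 < 1 / ((m % q : ℕ) : ℝ) := by positivity
  have h₂ : 0 < 1 / ((q : ℝ) - (m % q : ℕ)) := by positivity
  rw [dnint, abs_sub_round_eq_min, Int.fract_div_natCast_eq_div_natCast_mod]
  rcases min_choice (((m % q : ℕ) : ℝ) / q) (1 - ((m % q : ℕ) : ℝ) / q) with h | h <;> rw [h]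
  · rw [one_div_div, div_eq_mul_one_div]
    gcongr
    linarith
  · rw [one_sub_div hq'.ne', one_div_div, div_eq_mul_one_div]
    gcongr
    linarith

lemma sum_range_one_div_add_one_div_sub_le {q : ℕ} (hq : 0 < q) :
    ∑ r ∈ range q, (1 / (r : ℝ) + 1 / ((q : ℝ) - r)) ≤ 2 * (1 + Real.log q) := by
  have hH : ∑ i ∈ range q, 1 / ((i : ℝ) + 1) ≤ 1 + Real.log q := by
    have h := harmonic_le_one_add_log q
    simp only [harmonic] at h
    push_cast at h
    simpa using h
  have hrefl : ∑ r ∈ range q, 1 / ((q : ℝ) - r) = ∑ i ∈ range q, 1 / ((i : ℝ) + 1) := by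
    rw [← sum_range_reflect]
    refine sum_congr rfl fun i hi => ?_
    have hi := mem_range.1 hi
    have : ((q - 1 - i : ℕ) : ℝ) = q - 1 - i := by
      rw [Nat.cast_sub (by omega), Nat.cast_sub (by omega), Nat.cast_one]
    rw [this]
    ring_nf
  have hshift : ∑ r ∈ range q, 1 / (r : ℝ) ≤ ∑ i ∈ range q, 1 / ((i : ℝ) + 1) := by
    obtain ⟨k, rfl⟩ : ∃ k, q = k + 1 := ⟨q - 1, by omega⟩
    rw [sum_range_succ', sum_range_succ]
    push_cast
    simp only [div_zero, add_zero]
    exact le_add_of_nonneg_right (by positivity)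
  rw [sum_add_distrib, hrefl]
  linarith

/-- An interval of `N` integers contains at most `N / q + 1` solutions of a linear congruence
modulo `q` with invertible leading coefficient. -/
lemma card_filter_mul_mod_eq_le {a q : ℕ} (ha : Nat.Coprime a q) (A N r : ℕ) :
    #{n ∈ Ioc A (A + N) | a * n % q = r} ≤ N / q + 1 := by
  rw [← card_range (N / q + 1)]
  refine card_le_card_of_injOn (fun n => (n - A - 1) / q) ?_ ?_
  · intro n hn
    simp only [coe_filter, mem_Ioc, Set.mem_ofPred_eq] at hn
    simp only [coe_range, Set.mem_Iio]
    exact Nat.lt_succ_of_le (Nat.div_le_div_right (by omega))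
  · intro n hn n' hn' h
    simp only [coe_filter, mem_Ioc, Set.mem_ofPred_eq] at hn hn'
    have hmod : n ≡ n' [MOD q] :=
      Nat.ModEq.cancel_left_of_coprime (Nat.coprime_comm.1 ha) (hn.2.trans hn'.2.symm)
    have hmod' : n - A - 1 ≡ n' - A - 1 [MOD q] := by
      refine Nat.ModEq.add_right_cancel' (A + 1) ?_
      rwa [show n - A - 1 + (A + 1) = n by omega, show n' - A - 1 + (A + 1) = n' by omega]
    have h' : (n - A - 1) / q = (n' - A - 1) / q := h
    have e := Nat.div_add_mod (n - A - 1) q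
    rw [h', hmod', Nat.div_add_mod] at e
    omega

lemma sum_one_div_dnint_le_of_coprime {a q : ℕ} (hq : 0 < q) (ha : Nat.Coprime a q) (A N : ℕ) :
    ∑ n ∈ Ioc A (A + N) with ¬ q ∣ a * n, 1 / dnint (((a * n : ℕ) : ℝ) / q) ≤
      2 * (N + q) * (1 + Real.log q) := by
  have hq' : (0 : ℝ) < q := by exact_mod_cast hq
  set F : ℕ → ℝ := fun r => 1 / (r : ℝ) + 1 / ((q : ℝ) - r) with hF
  have hF0 : ∀ r < q, 0 ≤ F r := fun r hr => by
    have : (0 : ℝ) < (q : ℝ) - r := sub_pos.2 (by exact_mod_cast hr)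
    positivity
  calc
    _ ≤ ∑ n ∈ Ioc A (A + N) with ¬ q ∣ a * n, q * F (a * n % q) :=
        sum_le_sum fun n hn => one_div_dnint_natCast_div_le hq (mem_filter.1 hn).2
    _ ≤ ∑ n ∈ Ioc A (A + N), q * F (a * n % q) :=
        sum_le_sum_of_subset_of_nonneg (filter_subset _ _) fun n _ _ =>
          mul_nonneg hq'.le (hF0 _ (Nat.mod_lt _ hq))
    _ = ∑ r ∈ range q, ∑ n ∈ Ioc A (A + N) with a * n % q = r, q * F (a * n % q) :=
        (sum_fiberwise_of_maps_to (fun n _ => mem_range.2 (Nat.mod_lt _ hq)) _).symm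
    _ = ∑ r ∈ range q, #{n ∈ Ioc A (A + N) | a * n % q = r} * (q * F r) := by
        refine sum_congr rfl fun r _ => ?_
        rw [← nsmul_eq_mul, ← sum_const]
        exact sum_congr rfl fun n hn => by rw [(mem_filter.1 hn).2]
    _ ≤ ∑ r ∈ range q, ((N : ℝ) / q + 1) * (q * F r) := by
        refine sum_le_sum fun r hr => ?_
        have hFr := hF0 r (mem_range.1 hr)
        gcongr
        calc (#{n ∈ Ioc A (A + N) | a * n % q = r} : ℝ) ≤ ((N / q + 1 : ℕ) : ℝ) := by
              exact_mod_cast card_filter_mul_mod_eq_le ha A N r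
          _ ≤ (N : ℝ) / q + 1 := by
              push_cast
              gcongr
              exact Nat.cast_div_le
    _ = (N + q) * ∑ r ∈ range q, F r := by
        rw [mul_sum]
        refine sum_congr rfl fun r _ => ?_
        field_simp
    _ ≤ (N + q) * (2 * (1 + Real.log q)) := by
        gcongr
        exact sum_range_one_div_add_one_div_sub_le hq
    _ = _ := by ring

lemma sum_one_div_dnint_le {h k : ℕ} (hk : 0 < k) (A N : ℕ) :
    ∑ n ∈ Ioc A (A + N) with ¬ k ∣ h * n, 1 / dnint ((h : ℝ) * n / k) ≤
      2 * (N + k) * (1 + Real.log k) := by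
  obtain ⟨g, a, q, hg, hcop, rfl, rfl⟩ := Nat.exists_coprime' (m := h) (n := k)
    (Nat.gcd_pos_of_pos_right h hk)
  have hq : 0 < q := Nat.pos_of_mul_pos_right hk
  have hg' : (0 : ℝ) < g := by exact_mod_cast hg
  have hqk : (q : ℝ) ≤ (q * g : ℕ) := by exact_mod_cast Nat.le_mul_of_pos_right q hg
  have hq1 : (1 : ℝ) ≤ q := by exact_mod_cast hq
  calc
    _ = ∑ n ∈ Ioc A (A + N) with ¬ q ∣ a * n, 1 / dnint (((a * n : ℕ) : ℝ) / q) := by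
        refine sum_congr (filter_congr fun n _ => ?_) fun n _ => ?_
        · rw [mul_right_comm, Nat.mul_dvd_mul_iff_right hg]
        · push_cast
          rw [mul_right_comm, mul_div_mul_right _ _ hg'.ne']
    _ ≤ 2 * (N + q) * (1 + Real.log q) := sum_one_div_dnint_le_of_coprime hq hcop A N
    _ ≤ _ := by
        have := Real.log_nonneg hq1
        gcongr

/-- Kloosterman-type sum (bound for `Σ₆`): there is an absolute constant `C > 0` such that
for all reals `2 ≤ H₁ ≤ H₂`,
`Σ_{H₁ < h₁ ≤ 2H₁} Σ_{1 ≤ h ≤ H₁} (1/h) · Σ_{H₂ < h₂ ≤ 2H₂, h₁ ∤ h·h₂} 1/‖h·h₂/h₁‖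
  ≤ C·H₁·H₂·log²(2H₁)`. -/
theorem sigma6_bound :
    ∃ C : ℝ, 0 < C ∧ ∀ H₁ H₂ : ℝ, 2 ≤ H₁ → H₁ ≤ H₂ →
      ∑ h₁ ∈ Finset.Ioc ⌊H₁⌋₊ ⌊2 * H₁⌋₊, ∑ h ∈ Finset.Icc 1 ⌊H₁⌋₊,
          (1 / (h : ℝ)) *
            ∑ h₂ ∈ (Finset.Ioc ⌊H₂⌋₊ ⌊2 * H₂⌋₊).filter (fun h₂ => ¬ h₁ ∣ h * h₂),
              1 / dnint (((h : ℝ) * h₂) / h₁) ≤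
        C * H₁ * H₂ * Real.log (2 * H₁) ^ 2 := by
  refine ⟨64, by norm_num, fun H₁ H₂ h₁two h₁₂ => ?_⟩
  set L := Real.log (2 * H₁) with hL
  have hL1 : 1 ≤ L := by
    rw [hL, Real.le_log_iff_exp_le (by linarith)]
    linarith [Real.exp_one_lt_d9]
  have hfloor (x : ℝ) (hx : 2 ≤ x) : ((⌊2 * x⌋₊ - ⌊x⌋₊ : ℕ) : ℝ) ≤ 2 * x := by
    calc ((⌊2 * x⌋₊ - ⌊x⌋₊ : ℕ) : ℝ) ≤ (⌊2 * x⌋₊ : ℕ) := by exact_mod_cast Nat.sub_le _ _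
      _ ≤ 2 * x := Nat.floor_le (by linarith)
  have hinner (k h : ℕ) (hk : k ∈ Ioc ⌊H₁⌋₊ ⌊2 * H₁⌋₊) :
      ∑ n ∈ Ioc ⌊H₂⌋₊ ⌊2 * H₂⌋₊ with ¬ k ∣ h * n, 1 / dnint ((h : ℝ) * n / k) ≤
        16 * H₂ * L := by
    have hk0 : 0 < k := (Nat.zero_le _).trans_lt (mem_Ioc.1 hk).1
    have hk' : (0 : ℝ) < k := by exact_mod_cast hk0
    have hkle : (k : ℝ) ≤ 2 * H₁ := (Nat.le_floor_iff (by linarith)).1 (mem_Ioc.1 hk).2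
    have hbound := sum_one_div_dnint_le (h := h) hk0 ⌊H₂⌋₊ (⌊2 * H₂⌋₊ - ⌊H₂⌋₊)
    rw [Nat.add_sub_cancel' (Nat.floor_mono (by linarith))] at hbound
    have hlog : Real.log k ≤ L := Real.log_le_log hk' hkle
    have hN := hfloor H₂ (h₁two.trans h₁₂)
    calc _ ≤ _ := hbound
      _ ≤ 2 * (2 * H₂ + 2 * H₂) * (L + L) := by
          have := Real.log_natCast_nonneg k
          gcongr
          all_goals linarith
      _ = 16 * H₂ * L := by ring
  have hharm : ∑ h ∈ Icc 1 ⌊H₁⌋₊, 1 / (h : ℝ) ≤ 2 * L := by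
    have h := harmonic_floor_le_one_add_log H₁ (by linarith)
    rw [harmonic_eq_sum_Icc] at h
    push_cast at h
    have hlog : Real.log H₁ ≤ L := Real.log_le_log (by linarith) (by linarith)
    simp only [one_div]
    linarith
  calc
    _ ≤ ∑ _k ∈ Ioc ⌊H₁⌋₊ ⌊2 * H₁⌋₊, ∑ h ∈ Icc 1 ⌊H₁⌋₊, 1 / (h : ℝ) * (16 * H₂ * L) := by
        gcongr with k hk h _
        exact hinner k h hk
    _ = ((⌊2 * H₁⌋₊ - ⌊H₁⌋₊ : ℕ) : ℝ) *
          ((∑ h ∈ Icc 1 ⌊H₁⌋₊, 1 / (h : ℝ)) * (16 * H₂ * L)) := by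
        rw [sum_const, Nat.card_Ioc, nsmul_eq_mul, sum_mul]
    _ ≤ 2 * H₁ * (2 * L * (16 * H₂ * L)) := by
        have : 0 ≤ H₂ := by linarith
        gcongr
        exact hfloor H₁ h₁two
    _ = 64 * H₁ * H₂ * L ^ 2 := by ring
end

section
/- (Inner reciprocal-distance sum) There is an absolute constant C > 0 such that for every integer q ≥ 2, every integer a coprime to q, and every real H ≥ 1: Σ_{H < n ≤ 2H, q ∤ n} 1/‖a·n/q‖ ≤ C·(H/q + 2)·q·log q. -/
open Finset

theorem one_div_dnint_int_div_le {q : ℕ} (hq : 0 < q) (m : ℤ) (hm : ¬ (q : ℤ) ∣ m) :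
    1 / dnint ((m : ℝ) / q) ≤ (q : ℝ) / (m % q).toNat + (q : ℝ) / (q - (m % q).toNat : ℝ) := by
  have hq' : (0 : ℤ) < q := by exact_mod_cast hq
  have hpos : 0 < m % q :=
    lt_of_le_of_ne (Int.emod_nonneg m hq'.ne') fun h => hm (Int.dvd_of_emod_eq_zero h.symm)
  have hlt : m % q < q := Int.emod_lt_of_pos m hq'
  obtain ⟨r, hr⟩ := Int.eq_ofNat_of_zero_le hpos.le
  rw [dnint, abs_sub_round_eq_min, Int.fract_div_intCast_eq_div_intCast_mod, hr]
  rw [hr] at hpos hlt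
  have hr0 : (0 : ℝ) < r := by exact_mod_cast hpos
  have hrq : (0 : ℝ) < q - r := sub_pos.2 (by exact_mod_cast hlt)
  have hq0 : (0 : ℝ) < q := by exact_mod_cast hq
  have h1 : 1 - (r : ℝ) / q = (q - r) / q := by field_simp
  simp only [Int.toNat_natCast, Int.cast_natCast, h1]
  have h2 : 0 < (q : ℝ) / r := by positivity
  have h3 : 0 < (q : ℝ) / (q - r) := by positivity
  rcases min_choice ((r : ℝ) / q) ((q - r) / q) with h | h <;> rw [h, one_div_div] <;> linarith

theorem card_filter_modEq_Ioc_le {q : ℕ} (hq : 0 < q) {M N : ℕ} (hMN : M ≤ N) (v : ℕ) :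
    (((Ioc M N).filter (· ≡ v [MOD q])).card : ℝ) ≤ ((N : ℝ) - M) / q + 1 := by
  have hq0 : (0 : ℚ) < q := by exact_mod_cast hq
  have h := Nat.Ioc_filter_modEq_card M N hq v
  have h1 : ((((Ioc M N).filter (· ≡ v [MOD q])).card : ℤ) : ℚ) ≤ ((N : ℚ) - M) / q + 1 := by
    rw [h, Int.cast_max, max_le_iff]
    constructor
    · have h2 := Int.floor_le (((N : ℚ) - v) / q)
      have h3 := Int.lt_floor_add_one (((M : ℚ) - v) / q)
      have h4 : ((N : ℚ) - M) / q = (N - v) / q - (M - v) / q := by ring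
      push_cast
      linarith
    · have : (0 : ℚ) ≤ N - M := sub_nonneg.2 (by exact_mod_cast hMN)
      push_cast
      positivity
  have h2 := (Rat.cast_le (K := ℝ)).2 h1
  push_cast at h2
  exact h2

theorem sum_Ico_div_add_div_sub_le {q : ℕ} (hq : 2 ≤ q) :
    ∑ r ∈ Ico 1 q, ((q : ℝ) / r + (q : ℝ) / (q - r : ℝ)) ≤ 6 * q * Real.log q := by
  have hrefl : ∑ r ∈ Ico 1 q, (q : ℝ) / (q - r : ℝ) = ∑ r ∈ Ico 1 q, (q : ℝ) / r := by
    have h := Finset.sum_Ico_reflect (fun r : ℕ => (q : ℝ) / r) 1 (m := q) (n := q) (by omega)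
    rw [show q + 1 - q = 1 by omega, show q + 1 - 1 = q by omega] at h
    rw [← h]
    refine Finset.sum_congr rfl fun r hr => ?_
    rw [Nat.cast_sub (Finset.mem_Ico.1 hr).2.le]
  have hharm : ∑ r ∈ Ico 1 q, (q : ℝ) / r ≤ q * (1 + Real.log q) := by
    have h := harmonic_le_one_add_log q
    rw [harmonic_eq_sum_Icc] at h
    push_cast at h
    simp_rw [div_eq_mul_inv]
    rw [← Finset.mul_sum]
    refine mul_le_mul_of_nonneg_left (le_trans ?_ h) q.cast_nonneg
    exact Finset.sum_le_sum_of_subset_of_nonneg Finset.Ico_subset_Icc_self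
      fun _ _ _ => by positivity
  have hlog : 1 ≤ 2 * Real.log q := by
    have h := Real.log_le_log two_pos (by exact_mod_cast hq : (2 : ℝ) ≤ q)
    linarith [Real.log_two_gt_d9]
  rw [Finset.sum_add_distrib, hrefl]
  nlinarith [mul_le_mul_of_nonneg_left hlog (q.cast_nonneg : (0 : ℝ) ≤ q)]

/-- Inner reciprocal-distance sum: there is an absolute constant `C > 0` such that for every
integer `q ≥ 2`, every integer `a` coprime to `q`, and every real `H ≥ 1`,
`Σ_{H < n ≤ 2H, q ∤ n} 1/‖a·n/q‖ ≤ C·(H/q + 2)·q·log q`. -/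
theorem inner_reciprocal_distance_sum :
    ∃ C : ℝ, 0 < C ∧ ∀ q : ℕ, 2 ≤ q → ∀ a : ℤ, IsCoprime a (q : ℤ) →
      ∀ H : ℝ, 1 ≤ H →
        ∑ n ∈ (Finset.Ioc ⌊H⌋₊ ⌊2 * H⌋₊).filter (fun n => ¬ q ∣ n),
            1 / dnint (((a : ℝ) * n) / q) ≤
          C * (H / q + 2) * q * Real.log q := by
  refine ⟨6, by norm_num, fun q hq a ha H hH => ?_⟩
  have hq0 : (0 : ℝ) < q := by exact_mod_cast (by omega : 0 < q)
  have hqz : (0 : ℤ) < q := by exact_mod_cast (by omega : 0 < q)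
  set S := (Finset.Ioc ⌊H⌋₊ ⌊2 * H⌋₊).filter (fun n => ¬ q ∣ n)
  let res : ℕ → ℕ := fun n => ((a * n) % q).toNat
  let g : ℕ → ℝ := fun r => (q : ℝ) / r + (q : ℝ) / (q - r : ℝ)
  have hndvd : ∀ n ∈ S, ¬ (q : ℤ) ∣ a * n := fun n hn h =>
    (Finset.mem_filter.1 hn).2 (by exact_mod_cast ha.symm.dvd_of_dvd_mul_left h)
  have hmaps : ∀ n ∈ S, res n ∈ Ico 1 q := by
    intro n hn
    have h0 := Int.emod_nonneg (a * n) hqz.ne'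
    have h1 : (a * n) % q ≠ 0 := fun h => hndvd n hn (Int.dvd_of_emod_eq_zero h)
    have h2 := Int.emod_lt_of_pos (a * n) hqz
    simp only [res, Finset.mem_Ico]
    omega
  have hg : ∀ r ∈ Ico 1 q, 0 ≤ g r := by
    intro r hr
    have : (0 : ℝ) ≤ q - r := sub_nonneg.2 (by exact_mod_cast (Finset.mem_Ico.1 hr).2.le)
    simp only [g]
    positivity
  have hcard : ∀ r, ((S.filter (res · = r)).card : ℝ) ≤ H / q + 2 := by
    intro r
    rcases (S.filter (res · = r)).eq_empty_or_nonempty with h | ⟨v, hv⟩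
    · rw [h, Finset.card_empty, Nat.cast_zero]
      positivity
    have hsub : S.filter (res · = r) ⊆
        (Ioc ⌊H⌋₊ ⌊2 * H⌋₊).filter (· ≡ v [MOD q]) := by
      intro n hn
      rw [Finset.mem_filter] at hn hv ⊢
      refine ⟨(Finset.mem_filter.1 hn.1).1, ?_⟩
      have hmod : (a * n) % q = (a * v) % q := by
        have h := hn.2.trans hv.2.symm
        have h1 := Int.emod_nonneg (a * n) hqz.ne'
        have h2 := Int.emod_nonneg (a * v) hqz.ne'
        simp only [res] at h
        omega
      have hdvd : (q : ℤ) ∣ a * ((v : ℤ) - n) := by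
        rw [mul_sub]
        exact Int.ModEq.dvd hmod
      exact (Nat.modEq_iff_dvd).2 (ha.symm.dvd_of_dvd_mul_left hdvd)
    have h1 := card_filter_modEq_Ioc_le (q := q) (by omega)
      (Nat.floor_le_floor (by linarith : H ≤ 2 * H)) v
    have h2 : ((⌊2 * H⌋₊ : ℝ) - ⌊H⌋₊) / q ≤ H / q + 1 := by
      have h3 := Nat.floor_le (by linarith : 0 ≤ 2 * H)
      have h4 := Nat.lt_floor_add_one H
      have h5 : (2 : ℝ) ≤ q := by exact_mod_cast hq
      rw [div_add_one hq0.ne']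
      gcongr
      linarith
    have h3 : ((S.filter (res · = r)).card : ℝ) ≤
        ((Ioc ⌊H⌋₊ ⌊2 * H⌋₊).filter (· ≡ v [MOD q])).card := by
      exact_mod_cast Finset.card_le_card hsub
    linarith
  calc ∑ n ∈ S, 1 / dnint (((a : ℝ) * n) / q)
      ≤ ∑ n ∈ S, g (res n) := Finset.sum_le_sum fun n hn => by
        have h := one_div_dnint_int_div_le (by omega : 0 < q) (a * n) (hndvd n hn)
        push_cast at h
        exact h
    _ = ∑ r ∈ Ico 1 q, (S.filter (res · = r)).card * g r := by
        rw [← Finset.sum_fiberwise_of_maps_to hmaps]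
        refine Finset.sum_congr rfl fun r _ => ?_
        rw [Finset.sum_congr rfl fun n hn => by rw [(Finset.mem_filter.1 hn).2],
          Finset.sum_const, nsmul_eq_mul]
    _ ≤ ∑ r ∈ Ico 1 q, (H / q + 2) * g r :=
        Finset.sum_le_sum fun r hr => mul_le_mul_of_nonneg_right (hcard r) (hg r hr)
    _ = (H / q + 2) * ∑ r ∈ Ico 1 q, g r := by rw [Finset.mul_sum]
    _ ≤ (H / q + 2) * (6 * q * Real.log q) :=
        mul_le_mul_of_nonneg_left (sum_Ico_div_add_div_sub_le hq) (by positivity)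
    _ = 6 * (H / q + 2) * q * Real.log q := by ring
end

section
/- (Triple ψ-sum estimate) There is an absolute constant C > 0 with the following property. Let H₁, H₂, N₂ be reals with 2 ≤ H₁ ≤ H₂ and N₂ ≥ 2, and let c(h₁, h₂) be arbitrary real numbers depending only on h₁ and h₂. Then |Σ_{H₁ < h₁ ≤ 2H₁} Σ_{H₂ < h₂ ≤ 2H₂} Σ_{N₂ < n₂ ≤ 2N₂} ψ(h₂·n₂/h₁ + c(h₁, h₂))| ≤ C·(H₂N₂ + H₁H₂)·log²(2H₁). -/
open Finset

/-- `ψ(t) = t - ⌊t⌋ - 1/2`. -/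
noncomputable def psi (t : ℝ) : ℝ := Int.fract t - 1 / 2

/-- The weight `1/r + 1/(q-r)`, comparable to the inverse distance from `r` to `q ℤ`. -/
noncomputable def reciprocalWeight (q r : ℕ) : ℝ := (r : ℝ)⁻¹ + ((q : ℝ) - r)⁻¹

lemma reciprocalWeight_nonneg {q r : ℕ} (h : r ≤ q) : 0 ≤ reciprocalWeight q r := by
  have : (r : ℝ) ≤ q := by exact_mod_cast h
  unfold reciprocalWeight
  have := sub_nonneg.2 this
  positivity

lemma sum_Ico_one_reflect (f : ℕ → ℝ) (q : ℕ) :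
    ∑ k ∈ Ico 1 q, f (q - k) = ∑ k ∈ Ico 1 q, f k := by
  refine sum_nbij' (fun k => q - k) (fun k => q - k) ?_ ?_ ?_ ?_ fun _ _ => rfl <;>
  · intro k hk
    simp only [mem_Ico] at hk ⊢
    omega

lemma sum_mul_reciprocalWeight (f : ℕ → ℝ) (q : ℕ)
    (hf : ∀ k ∈ Ico 1 q, f (q - k) = f k) :
    ∑ k ∈ Ico 1 q, f k * reciprocalWeight q k = 2 * ∑ k ∈ Ico 1 q, f k * (k : ℝ)⁻¹ := by
  simp only [reciprocalWeight, mul_add, sum_add_distrib, two_mul]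
  congr 1
  rw [← sum_Ico_one_reflect (fun k => f k * (k : ℝ)⁻¹)]
  refine sum_congr rfl fun k hk => ?_
  rw [hf k hk, Nat.cast_sub (mem_Ico.1 hk).2.le]

lemma sum_inv_le_one_add_log {n : ℕ} {x : ℝ} (hx : 1 ≤ x) (hn : n ≤ x) :
    ∑ k ∈ Icc 1 n, (k : ℝ)⁻¹ ≤ 1 + Real.log x := by
  have h := harmonic_le_one_add_log n
  simp only [harmonic_eq_sum_Icc, Rat.cast_sum, Rat.cast_inv, Rat.cast_natCast] at h
  refine h.trans ?_
  rcases Nat.eq_zero_or_pos n with rfl | h0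
  · simpa using Real.log_nonneg hx
  · have : (0 : ℝ) < n := by exact_mod_cast h0
    gcongr

lemma sum_reciprocalWeight_le {q : ℕ} {x : ℝ} (hx : 1 ≤ x) (hq : q ≤ x) :
    ∑ k ∈ Ico 1 q, reciprocalWeight q k ≤ 2 * (1 + Real.log x) := by
  have h := sum_mul_reciprocalWeight (fun _ => 1) q (fun _ _ => rfl)
  simp only [one_mul] at h
  rw [h]
  gcongr
  refine le_trans (sum_le_sum_of_subset_of_nonneg ?_ ?_) (sum_inv_le_one_add_log hx hq)
  · intro k; simp only [mem_Ico, mem_Icc]; omega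
  · intros; positivity

lemma sum_gcd_mul_inv_le {q : ℕ} {x : ℝ} (hx : 1 ≤ x) (hq : q ≤ x) :
    ∑ k ∈ Ico 1 q, (q.gcd k : ℝ) * (k : ℝ)⁻¹ ≤ #q.divisors * (1 + Real.log x) := by
  rcases Nat.eq_zero_or_pos q with rfl | hq0
  · simp
  calc ∑ k ∈ Ico 1 q, (q.gcd k : ℝ) * (k : ℝ)⁻¹
      ≤ ∑ k ∈ Ico 1 q, ∑ d ∈ q.divisors, if d ∣ k then (d : ℝ) * (k : ℝ)⁻¹ else 0 := by
        refine sum_le_sum fun k _ => ?_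
        have h := single_le_sum (f := fun d : ℕ => if d ∣ k then (d : ℝ) * (k : ℝ)⁻¹ else 0)
          (s := q.divisors) (fun d _ => by split_ifs <;> positivity)
          (Nat.mem_divisors.2 ⟨Nat.gcd_dvd_left q k, hq0.ne'⟩)
        simpa [Nat.gcd_dvd_right] using h
    _ = ∑ d ∈ q.divisors, ∑ k ∈ Ico 1 q with d ∣ k, (d : ℝ) * (k : ℝ)⁻¹ := by
        rw [sum_comm]
        simp only [sum_filter]
    _ ≤ ∑ d ∈ q.divisors, (1 + Real.log x) := by
        refine sum_le_sum fun d hd => ?_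
        have hd0 : 0 < d := Nat.pos_of_mem_divisors hd
        refine le_trans (le_trans (sum_le_sum_of_subset_of_nonneg
          (t := (Icc 1 q).image (d * ·)) ?_ ?_) (le_of_eq (sum_image ?_)))
          (le_trans (le_of_eq (sum_congr rfl fun k _ => ?_)) (sum_inv_le_one_add_log hx hq))
        · intro k
          simp only [mem_filter, mem_Ico, mem_image, mem_Icc]
          rintro ⟨⟨h1, h2⟩, e, rfl⟩
          exact ⟨e, ⟨Nat.pos_of_mul_pos_left h1 , by nlinarith⟩, rfl⟩
        · intros; positivity
        · intro a _ b _ h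
          exact Nat.eq_of_mul_eq_mul_left hd0 h
        · have : (d : ℝ) ≠ 0 := by positivity
          push_cast
          rw [mul_inv, mul_inv_cancel_left₀ this]
    _ = _ := by rw [sum_const, nsmul_eq_mul]

lemma sum_gcd_mul_reciprocalWeight_le {q : ℕ} {x : ℝ} (hx : 1 ≤ x) (hq : q ≤ x) :
    ∑ k ∈ Ico 1 q, (q.gcd k : ℝ) * reciprocalWeight q k ≤
      2 * (#q.divisors * (1 + Real.log x)) := by
  rw [sum_mul_reciprocalWeight]
  · gcongr
    exact sum_gcd_mul_inv_le hx hq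
  · intro k hk
    rw [Nat.gcd_self_sub_right (mem_Ico.1 hk).2.le]

lemma sum_range_add_of_periodic {f : ℕ → ℝ} {q : ℕ} (hf : Function.Periodic f q) (a : ℕ) :
    ∑ i ∈ range q, f (a + i) = ∑ i ∈ range q, f i := by
  induction a with
  | zero => simp
  | succ a ih =>
    have h1 := sum_range_succ (fun i => f (a + i)) q
    have h2 := sum_range_succ' (fun i => f (a + i)) q
    have h3 := hf a
    simp only [add_zero] at h2
    rw [← ih]
    have h4 : ∑ i ∈ range q, f (a + 1 + i) = ∑ i ∈ range q, f (a + (i + 1)) :=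
      sum_congr rfl fun i _ => by ring_nf
    linarith

lemma sum_range_mul_of_periodic {f : ℕ → ℝ} {q : ℕ} (hf : Function.Periodic f q) (a m : ℕ) :
    ∑ i ∈ range (m * q), f (a + i) = m * ∑ i ∈ range q, f i := by
  induction m with
  | zero => simp
  | succ m ih =>
    rw [Nat.succ_mul, sum_range_add, ih]
    simp only [← add_assoc]
    rw [sum_range_add_of_periodic hf]
    push_cast; ring

lemma sum_Ioc_le_of_periodic {f : ℕ → ℝ} {q : ℕ} (hf : Function.Periodic f q)
    (h0 : ∀ i, 0 ≤ f i) (hq : 0 < q) (a b : ℕ) :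
    ∑ i ∈ Ioc a b, f i ≤ ((b - a : ℕ) / q + 1 : ℝ) * ∑ i ∈ range q, f i := by
  calc ∑ i ∈ Ioc a b, f i
      ≤ ∑ i ∈ Ico (a + 1) (a + 1 + ((b - a) / q + 1) * q), f i := by
        refine sum_le_sum_of_subset_of_nonneg ?_ fun i _ _ => h0 i
        intro i
        have := Nat.lt_div_mul_add (a := b - a) hq
        simp only [mem_Ioc, mem_Ico, add_mul]
        omega
    _ = (((b - a) / q + 1 : ℕ) : ℝ) * ∑ i ∈ range q, f i := by
        rw [sum_Ico_eq_sum_range, Nat.add_sub_cancel_left, sum_range_mul_of_periodic hf]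
    _ ≤ _ := by
        gcongr
        · exact sum_nonneg fun i _ => h0 i
        · push_cast
          gcongr
          exact Nat.cast_div_le

lemma sum_range_mul_mod_of_coprime (g : ℕ → ℝ) {q k : ℕ} (hq : 0 < q) (h : q.Coprime k) :
    ∑ b ∈ range q, g (k * b % q) = ∑ r ∈ range q, g r := by
  have hm : Set.MapsTo (fun b => k * b % q) (range q : Set ℕ) (range q) := by
    intro b _
    simpa using Nat.mod_lt _ hq
  have hi : Set.InjOn (fun b => k * b % q) (range q : Set ℕ) := by
    intro a ha b hb hab
    have h1 : a ≡ b [MOD q] := Nat.ModEq.cancel_left_of_coprime h hab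
    simp only [coe_range, Set.mem_Iio] at ha hb
    exact h1.eq_of_lt_of_lt ha hb
  exact sum_nbij (fun b => k * b % q) hm hi
    (surjOn_of_injOn_of_card_le _ hm hi le_rfl) fun _ _ => rfl

lemma sum_range_mul_mod (g : ℕ → ℝ) {q k : ℕ} (hq : 0 < q) :
    ∑ b ∈ range q, g (k * b % q) =
      q.gcd k * ∑ r ∈ range (q / q.gcd k), g (q.gcd k * r) := by
  obtain ⟨d, hd⟩ : ∃ d, d = q.gcd k := ⟨_, rfl⟩
  have hd0 : 0 < d := hd ▸ Nat.gcd_pos_of_pos_left k hq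
  obtain ⟨q', hq'⟩ : d ∣ q := hd ▸ Nat.gcd_dvd_left q k
  obtain ⟨k', hk'⟩ : d ∣ k := hd ▸ Nat.gcd_dvd_right q k
  rw [← hd]
  have hco : q'.Coprime k' := by
    have : d * q'.gcd k' = d * 1 := by rw [← Nat.gcd_mul_left, ← hq', ← hk', ← hd, mul_one]
    exact Nat.eq_of_mul_eq_mul_left hd0 this
  subst hq' hk'
  have hq'0 : 0 < q' := Nat.pos_of_mul_pos_left hq
  rw [Nat.mul_div_cancel_left _ hd0, ← sum_range_mul_mod_of_coprime _ hq'0 hco]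
  have hper : Function.Periodic (fun b => g (d * (k' * b % q'))) q' := by
    intro b
    simp only [mul_add, Nat.add_mul_mod_self_right]
  have := sum_range_mul_of_periodic hper 0 d
  simp only [zero_add] at this
  rw [← this]
  simp only [mul_assoc, Nat.mul_mod_mul_left]

lemma two_mul_mul_one_sub_le_sin {t : ℝ} (h0 : 0 ≤ t) (h1 : t ≤ 1) :
    2 * t * (1 - t) ≤ Real.sin (Real.pi * t) := by
  have hpi := Real.pi_pos
  rcases le_total t (1 / 2) with h | h
  · have := Real.mul_le_sin (x := Real.pi * t) (by positivity) (by nlinarith)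
    rw [show 2 / Real.pi * (Real.pi * t) = 2 * t by field_simp] at this
    nlinarith
  · have := Real.mul_le_sin (x := Real.pi * (1 - t)) (mul_nonneg hpi.le (by linarith))
      (by nlinarith)
    rw [show 2 / Real.pi * (Real.pi * (1 - t)) = 2 * (1 - t) by field_simp,
      show Real.pi * (1 - t) = Real.pi - Real.pi * t by ring, Real.sin_pi_sub] at this
    nlinarith

/-- The standard primitive `q`-th root of unity. -/
noncomputable def stdRoot (q : ℕ) : ℂ := Complex.exp (2 * Real.pi * Complex.I / q)

lemma stdRoot_isPrimitiveRoot {q : ℕ} (hq : q ≠ 0) : IsPrimitiveRoot (stdRoot q) q :=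
  Complex.isPrimitiveRoot_exp q hq

lemma norm_stdRoot {q : ℕ} (hq : q ≠ 0) : ‖stdRoot q‖ = 1 :=
  (stdRoot_isPrimitiveRoot hq).norm'_eq_one hq

lemma inv_norm_stdRoot_pow_sub_one_le {q r : ℕ} (h0 : 0 < r) (h1 : r < q) :
    ‖stdRoot q ^ r - 1‖⁻¹ ≤ q / 4 * reciprocalWeight q r := by
  have hr : (0 : ℝ) < r := by exact_mod_cast h0
  have hrq : (r : ℝ) < q := by exact_mod_cast h1
  have hq : (0 : ℝ) < q := hr.trans hrq
  have hqr : (0 : ℝ) < q - r := sub_pos.2 hrq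
  have e : stdRoot q ^ r = Complex.exp (Complex.I * ((2 * (Real.pi * (r / q)) : ℝ) : ℂ)) := by
    rw [stdRoot, ← Complex.exp_nat_mul]
    congr 1
    push_cast
    ring
  have hs := two_mul_mul_one_sub_le_sin (t := r / q) (by positivity) ((div_le_one hq).2 hrq.le)
  rw [e, Complex.norm_exp_I_mul_ofReal_sub_one, mul_div_cancel_left₀ _ (two_ne_zero' ℝ),
    Real.norm_eq_abs]
  have hpos : 0 < 4 * ((r : ℝ) / q) * (1 - r / q) := by
    rw [one_sub_div hq.ne']; positivity
  refine (inv_anti₀ hpos (le_trans ?_ (le_abs_self _))).trans (le_of_eq ?_)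
  · linarith
  · rw [one_sub_div hq.ne', reciprocalWeight]
    field_simp
    ring

lemma norm_sum_Ioc_pow_le {w : ℂ} (hw : ‖w‖ = 1) (h1 : w ≠ 1) (a b : ℕ) :
    ‖∑ n ∈ Ioc a b, w ^ n‖ ≤ 2 * ‖w - 1‖⁻¹ := by
  rcases le_total a b with hab | hab
  · rw [← Ico_add_one_add_one_eq_Ioc, geom_sum_Ico h1 (by omega), norm_div, div_eq_mul_inv]
    gcongr
    refine (norm_sub_le _ _).trans ?_
    simp only [norm_pow, hw, one_pow]
    norm_num
  · rw [Ioc_eq_empty_of_le hab]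
    simp

lemma re_inv_sub_one {v : ℂ} (hv : ‖v‖ = 1) (h1 : v ≠ 1) : (v - 1)⁻¹.re = -1 / 2 := by
  have h2 : Complex.normSq v = 1 := by rw [Complex.normSq_eq_norm_sq, hv, one_pow]
  have h3 : Complex.normSq (v - 1) ≠ 0 := by simpa [sub_eq_zero] using h1
  have h4 : Complex.normSq (v - 1) = 2 - 2 * v.re := by
    rw [Complex.normSq_apply] at h2 ⊢
    simp only [Complex.sub_re, Complex.sub_im, Complex.one_re, Complex.one_im]
    linarith
  rw [Complex.inv_re, div_eq_iff h3, h4]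
  simp
  ring

lemma sum_Ico_stdRoot_pow_zpow {q : ℕ} (hq : q ≠ 0) (m : ℤ) :
    ∑ k ∈ Ico 1 q, (stdRoot q ^ k) ^ m = if (q : ℤ) ∣ m then (q : ℂ) - 1 else -1 := by
  have hζ := stdRoot_isPrimitiveRoot hq
  have h : ∑ k ∈ Ico 1 q, (stdRoot q ^ k) ^ m = ∑ k ∈ range q, (stdRoot q ^ m) ^ k - 1 := by
    rw [range_eq_Ico, sum_eq_sum_Ico_succ_bot (Nat.pos_of_ne_zero hq)]
    simp only [pow_zero, zero_add, add_sub_cancel_left]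
    refine sum_congr rfl fun k _ => ?_
    rw [← zpow_natCast, ← zpow_natCast, ← zpow_mul, ← zpow_mul, mul_comm]
  rw [h]
  split_ifs with hd
  · rw [(hζ.zpow_eq_one_iff_dvd m).2 hd]
    simp
  · have hne : stdRoot q ^ m ≠ 1 := fun h => hd ((hζ.zpow_eq_one_iff_dvd m).1 h)
    rw [geom_sum_eq hne, ← zpow_natCast, ← zpow_mul, mul_comm, zpow_mul, zpow_natCast,
      hζ.pow_eq_one, one_zpow]
    simp

lemma emod_add_one_eq {q : ℕ} (hq : q ≠ 0) (m : ℤ) :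
    (m + 1) % q = m % q + 1 - if (q : ℤ) ∣ m + 1 then (q : ℤ) else 0 := by
  have hq0 : (0 : ℤ) < q := by positivity
  have h1 := Int.emod_nonneg m hq0.ne'
  have h2 := Int.emod_lt_of_pos m hq0
  split_ifs with h
  · rw [Int.emod_eq_zero_of_dvd h]
    have h3 : (q : ℤ) ∣ m % q + 1 := by
      rw [Int.dvd_iff_emod_eq_zero, Int.emod_add_emod]
      exact Int.emod_eq_zero_of_dvd h
    have := Int.le_of_dvd (by omega) h3
    omega
  · rw [← Int.emod_add_emod, sub_zero]
    refine Int.emod_eq_of_lt (by omega) (lt_of_le_of_ne (by omega) fun h3 => h ?_)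
    rw [Int.dvd_iff_emod_eq_zero, ← Int.emod_add_emod, h3, Int.emod_self]

/-- The finite Fourier expansion of the residue of an integer modulo `q`. -/
lemma emod_eq_re_sum {q : ℕ} (hq : q ≠ 0) (m : ℤ) :
    ((m % q : ℤ) : ℝ) = ((q : ℝ) - 1) / 2 +
      (∑ k ∈ Ico 1 q, (stdRoot q ^ k) ^ m * ((stdRoot q ^ k)⁻¹ - 1)⁻¹).re := by
  have hζ := stdRoot_isPrimitiveRoot hq
  have hζ0 : stdRoot q ≠ 0 := hζ.ne_zero hq
  have hne : ∀ k ∈ Ico 1 q, (stdRoot q ^ k)⁻¹ ≠ 1 := fun k hk h => by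
    rw [inv_eq_one, hζ.pow_eq_one_iff_dvd] at h
    have := Nat.le_of_dvd (mem_Ico.1 hk).1 h
    exact absurd (mem_Ico.1 hk).2 (by omega)
  have step : ∀ m : ℤ,
      ∑ k ∈ Ico 1 q, (stdRoot q ^ k) ^ m * ((stdRoot q ^ k)⁻¹ - 1)⁻¹ =
        ∑ k ∈ Ico 1 q, (stdRoot q ^ k) ^ (m + 1) * ((stdRoot q ^ k)⁻¹ - 1)⁻¹ +
          ∑ k ∈ Ico 1 q, (stdRoot q ^ k) ^ (m + 1) := by
    intro m
    rw [← sum_add_distrib]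
    refine sum_congr rfl fun k hk => ?_
    have hk0 : stdRoot q ^ k ≠ 0 := pow_ne_zero _ hζ0
    have h1 := sub_ne_zero.2 (hne k hk)
    have h2 : (stdRoot q ^ k) ^ m = (stdRoot q ^ k) ^ (m + 1) * (stdRoot q ^ k)⁻¹ := by
      rw [zpow_add_one₀ hk0, mul_inv_cancel_right₀ hk0]
    rw [h2, ← div_eq_mul_inv _ ((stdRoot q ^ k)⁻¹ - 1), ← div_eq_mul_inv _ ((stdRoot q ^ k)⁻¹ - 1),
      div_add' _ _ _ h1]
    ring
  have stepRe : ∀ m : ℤ, ((m % q : ℤ) : ℝ) = ((q : ℝ) - 1) / 2 +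
        (∑ k ∈ Ico 1 q, (stdRoot q ^ k) ^ m * ((stdRoot q ^ k)⁻¹ - 1)⁻¹).re ↔
      (((m + 1) % q : ℤ) : ℝ) = ((q : ℝ) - 1) / 2 +
        (∑ k ∈ Ico 1 q, (stdRoot q ^ k) ^ (m + 1) * ((stdRoot q ^ k)⁻¹ - 1)⁻¹).re := by
    intro m
    rw [step m, emod_add_one_eq hq, sum_Ico_stdRoot_pow_zpow hq, Complex.add_re]
    split_ifs
    · simp
      constructor <;> intro h <;> linarith
    · simp
      constructor <;> intro h <;> linarith
  induction m with
  | zero =>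
    simp only [zpow_zero, one_mul, Complex.re_sum]
    rw [sum_congr rfl fun k hk => re_inv_sub_one
      (by rw [norm_inv, norm_pow, norm_stdRoot hq, one_pow, inv_one]) (hne k hk)]
    have : (1 : ℕ) ≤ q := Nat.pos_of_ne_zero hq
    simp [Nat.cast_sub this]
    ring
  | succ m ih => exact (stepRe _).1 ih
  | pred m ih =>
    refine (stepRe _).2 ?_
    rwa [sub_add_cancel]

lemma fract_natCast_div_add {q : ℕ} (hq : q ≠ 0) (m : ℕ) (c : ℝ) :
    Int.fract ((m : ℝ) / q + c) =
      ((((m : ℤ) + ⌊(q : ℝ) * c⌋) % q : ℤ) + Int.fract ((q : ℝ) * c)) / q := by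
  have hq0 : (0 : ℝ) < q := by positivity
  have hq1 : (0 : ℤ) < q := by positivity
  obtain ⟨N, hN⟩ : ∃ N : ℤ, N = (m : ℤ) + ⌊(q : ℝ) * c⌋ := ⟨_, rfl⟩
  rw [← hN]
  have h1 : (0 : ℝ) ≤ (N % q : ℤ) := by exact_mod_cast Int.emod_nonneg N hq1.ne'
  have h2 : ((N % q : ℤ) : ℝ) + 1 ≤ q := by exact_mod_cast Int.emod_lt_of_pos N hq1
  have h3 := Int.fract_nonneg ((q : ℝ) * c)
  have h4 := Int.fract_lt_one ((q : ℝ) * c)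
  refine Int.fract_eq_iff.2 ⟨by positivity, by rw [div_lt_one hq0]; linarith, N / q, ?_⟩
  have h5 : (N : ℝ) = m + ⌊(q : ℝ) * c⌋ := by rw [hN]; push_cast; ring
  have h6 : (q : ℝ) * (N / q : ℤ) + (N % q : ℤ) = N := by exact_mod_cast Int.mul_ediv_add_emod N q
  have h7 := Int.floor_add_fract ((q : ℝ) * c)
  field_simp
  linarith

/-- An upper bound for a sum of `M` consecutive powers of the `r`-th power of `stdRoot q`. -/
noncomputable def geomBound (M : ℝ) (q r : ℕ) : ℝ :=
  if r = 0 then M else q / 2 * reciprocalWeight q r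

lemma geomBound_nonneg {M : ℝ} (hM : 0 ≤ M) {q r : ℕ} (h : r ≤ q) : 0 ≤ geomBound M q r := by
  have := reciprocalWeight_nonneg h
  unfold geomBound
  split_ifs <;> positivity

lemma norm_sum_stdRoot_pow_le {q : ℕ} (hq : q ≠ 0) (j A B : ℕ) :
    ‖∑ n ∈ Ioc A B, (stdRoot q ^ j) ^ n‖ ≤ geomBound (B - A : ℕ) q (j % q) := by
  have hζ := stdRoot_isPrimitiveRoot hq
  rw [pow_eq_pow_mod j hζ.pow_eq_one]
  have hlt := Nat.mod_lt j (Nat.pos_of_ne_zero hq)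
  generalize j % q = r at hlt ⊢
  unfold geomBound
  split_ifs with h
  · simp [h]
  · have hne : stdRoot q ^ r ≠ 1 := hζ.pow_ne_one_of_pos_of_lt h hlt
    have h1 := norm_sum_Ioc_pow_le (w := stdRoot q ^ r)
      (by rw [norm_pow, norm_stdRoot hq, one_pow]) hne A B
    have h2 := inv_norm_stdRoot_pow_sub_one_le (Nat.pos_of_ne_zero h) hlt
    linarith

lemma abs_sum_psi_le {q : ℕ} (hq : q ≠ 0) (b A B : ℕ) (c : ℝ) :
    |∑ n ∈ Ioc A B, psi ((b : ℝ) * n / q + c)| ≤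
      (B - A : ℕ) / q + 1 / 4 * ∑ k ∈ Ico 1 q,
        reciprocalWeight q k * geomBound (B - A : ℕ) q (k * b % q) := by
  have hζ0 : stdRoot q ≠ 0 := (stdRoot_isPrimitiveRoot hq).ne_zero hq
  have hq0 : (0 : ℝ) < q := by positivity
  set z := ⌊(q : ℝ) * c⌋ with hz
  set θ := Int.fract ((q : ℝ) * c) with hθ
  have hpsi : ∀ n : ℕ, psi ((b : ℝ) * n / q + c) = (θ - 1 / 2) / q +
      1 / q * (∑ k ∈ Ico 1 q, (stdRoot q ^ k) ^ (((b * n : ℕ) : ℤ) + z) *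
        ((stdRoot q ^ k)⁻¹ - 1)⁻¹).re := by
    intro n
    have h := fract_natCast_div_add hq (b * n) c
    rw [emod_eq_re_sum hq] at h
    rw [psi, ← Nat.cast_mul, h, ← hz, ← hθ]
    field_simp
    ring
  have hswap : ∑ n ∈ Ioc A B, ∑ k ∈ Ico 1 q, (stdRoot q ^ k) ^ (((b * n : ℕ) : ℤ) + z) *
        ((stdRoot q ^ k)⁻¹ - 1)⁻¹ = ∑ k ∈ Ico 1 q, ((stdRoot q ^ k) ^ z *
          ((stdRoot q ^ k)⁻¹ - 1)⁻¹) * ∑ n ∈ Ioc A B, (stdRoot q ^ (k * b)) ^ n := by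
    rw [sum_comm]
    refine sum_congr rfl fun k _ => ?_
    rw [mul_sum]
    refine sum_congr rfl fun n _ => ?_
    rw [zpow_add₀ (pow_ne_zero _ hζ0), zpow_natCast, ← pow_mul, ← pow_mul, mul_assoc k b n]
    ring
  have hnorm : ‖∑ k ∈ Ico 1 q, ((stdRoot q ^ k) ^ z * ((stdRoot q ^ k)⁻¹ - 1)⁻¹) *
      ∑ n ∈ Ioc A B, (stdRoot q ^ (k * b)) ^ n‖ ≤ ∑ k ∈ Ico 1 q,
        (q / 4 * reciprocalWeight q k) * geomBound (B - A : ℕ) q (k * b % q) := by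
    refine norm_sum_le_of_le _ fun k hk => ?_
    obtain ⟨hk1, hk2⟩ := mem_Ico.1 hk
    have hw : ‖stdRoot q ^ k‖ = 1 := by rw [norm_pow, norm_stdRoot hq, one_pow]
    have hinv : ‖(stdRoot q ^ k)⁻¹ - 1‖ = ‖stdRoot q ^ k - 1‖ := by
      have hk0 : stdRoot q ^ k ≠ 0 := pow_ne_zero _ hζ0
      rw [← mul_one ‖(stdRoot q ^ k)⁻¹ - 1‖, ← hw, ← norm_mul, sub_mul, inv_mul_cancel₀ hk0,
        one_mul, norm_sub_rev]
    rw [norm_mul, norm_mul, norm_zpow, hw, one_zpow, one_mul, norm_inv, hinv]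
    exact mul_le_mul (inv_norm_stdRoot_pow_sub_one_le hk1 hk2) (norm_sum_stdRoot_pow_le hq _ _ _)
      (norm_nonneg _) (mul_nonneg (by positivity) (reciprocalWeight_nonneg hk2.le))
  have hθ1 : |(θ - 1 / 2) / q| ≤ 1 / q := by
    rw [abs_div, abs_of_pos hq0]
    gcongr
    rw [abs_le]
    have h1 := Int.fract_nonneg ((q : ℝ) * c)
    have h2 := Int.fract_lt_one ((q : ℝ) * c)
    constructor <;> linarith
  simp only [hpsi]
  rw [sum_add_distrib, ← mul_sum, ← Complex.re_sum, hswap]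
  refine (abs_add_le _ _).trans (add_le_add ?_ ?_)
  · rw [sum_const, Nat.card_Ioc, nsmul_eq_mul, abs_mul, Nat.abs_cast,
      div_eq_mul_one_div ((B - A : ℕ) : ℝ)]
    exact mul_le_mul_of_nonneg_left hθ1 (Nat.cast_nonneg _)
  · rw [abs_mul, abs_of_pos (by positivity)]
    refine (mul_le_mul_of_nonneg_left ((Complex.abs_re_le_norm _).trans hnorm)
      (by positivity)).trans (le_of_eq ?_)
    rw [mul_sum, mul_sum]
    refine sum_congr rfl fun k _ => ?_
    field_simp

lemma sum_range_geomBound_le {q : ℕ} (hq : 0 < q) (k : ℕ) {M x : ℝ}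
    (hx : 1 ≤ x) (hqx : q ≤ x) :
    ∑ b ∈ range q, geomBound M q (k * b % q) ≤ q.gcd k * M + q * (1 + Real.log x) := by
  rw [sum_range_mul_mod _ hq]
  obtain ⟨d, hd⟩ : ∃ d, d = q.gcd k := ⟨_, rfl⟩
  rw [← hd]
  have hd0 : 0 < d := hd ▸ Nat.gcd_pos_of_pos_left k hq
  obtain ⟨q', hq'⟩ : d ∣ q := hd ▸ Nat.gcd_dvd_left q k
  clear hd
  subst hq'
  have hq'0 : 0 < q' := Nat.pos_of_mul_pos_left hq
  have hdR : (0 : ℝ) < d := by exact_mod_cast hd0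
  have hd1 : (1 : ℝ) ≤ d := by exact_mod_cast hd0
  rw [Nat.mul_div_cancel_left _ hd0, range_eq_Ico, sum_eq_sum_Ico_succ_bot hq'0, mul_add]
  refine add_le_add (by simp [geomBound]) ?_
  have h : ∀ r ∈ Ico (0 + 1) q', geomBound M (d * q') (d * r) =
      q' / 2 * reciprocalWeight q' r := by
    intro r hr
    have hr0 : d * r ≠ 0 := Nat.mul_ne_zero hd0.ne' (by have := (mem_Ico.1 hr).1; omega)
    rw [geomBound, if_neg hr0, reciprocalWeight, reciprocalWeight]
    push_cast
    rw [← mul_sub, mul_inv, mul_inv, ← mul_add]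
    field_simp
  rw [sum_congr rfl h, ← mul_sum]
  have hq'x : (q' : ℝ) ≤ x := by
    refine le_trans ?_ hqx
    push_cast
    exact le_mul_of_one_le_left (Nat.cast_nonneg _) hd1
  calc (d : ℝ) * (q' / 2 * ∑ r ∈ Ico (0 + 1) q', reciprocalWeight q' r)
      ≤ d * (q' / 2 * (2 * (1 + Real.log x))) := by
        gcongr
        exact sum_reciprocalWeight_le hx hq'x
    _ = _ := by push_cast; ring

lemma sum_sum_abs_psi_le {q : ℕ} (hq : 0 < q) (A B A' B' : ℕ) (c : ℕ → ℝ) {x : ℝ}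
    (hx : 1 ≤ x) (hqx : q ≤ x) :
    ∑ b ∈ Ioc A' B', |∑ n ∈ Ioc A B, psi ((b : ℝ) * n / q + c b)| ≤
      ((B' - A' : ℕ) / q + 1) * ((B - A : ℕ) +
        (#q.divisors * (1 + Real.log x) * (B - A : ℕ) + q * (1 + Real.log x) ^ 2) / 2) := by
  set M : ℝ := ((B - A : ℕ) : ℝ) with hM
  have hM0 : 0 ≤ M := Nat.cast_nonneg _
  have hlog := Real.log_nonneg hx
  have hqR : (0 : ℝ) < q := by exact_mod_cast hq
  have hw : ∀ k ∈ Ico 1 q, 0 ≤ reciprocalWeight q k := fun k hk =>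
    reciprocalWeight_nonneg (mem_Ico.1 hk).2.le
  refine (sum_le_sum fun b _ => abs_sum_psi_le hq.ne' b A B (c b)).trans ?_
  refine (sum_Ioc_le_of_periodic (q := q) ?_ ?_ hq A' B').trans ?_
  · intro b
    simp only [mul_add, Nat.add_mul_mod_self_right]
  · intro b
    refine add_nonneg (by positivity) (mul_nonneg (by norm_num) (sum_nonneg fun k hk => ?_))
    exact mul_nonneg (hw k hk) (geomBound_nonneg hM0 (Nat.mod_lt _ hq).le)
  · gcongr
    rw [sum_add_distrib, ← mul_sum, sum_comm]
    refine add_le_add ?_ ?_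
    · rw [sum_const, card_range, nsmul_eq_mul, mul_div_cancel₀ _ hqR.ne']
    · simp only [← mul_sum]
      calc 1 / 4 * ∑ k ∈ Ico 1 q,
            reciprocalWeight q k * ∑ b ∈ range q, geomBound M q (k * b % q)
          ≤ 1 / 4 * ∑ k ∈ Ico 1 q,
            reciprocalWeight q k * (q.gcd k * M + q * (1 + Real.log x)) := by
            gcongr with k hk
            · exact hw k hk
            · exact sum_range_geomBound_le hq k hx hqx
        _ = 1 / 4 * (M * ∑ k ∈ Ico 1 q, (q.gcd k : ℝ) * reciprocalWeight q k +
            q * (1 + Real.log x) * ∑ k ∈ Ico 1 q, reciprocalWeight q k) := by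
            congr 1
            rw [mul_sum, mul_sum, ← sum_add_distrib]
            refine sum_congr rfl fun k _ => ?_
            ring
        _ ≤ 1 / 4 * (M * (2 * (#q.divisors * (1 + Real.log x))) +
            q * (1 + Real.log x) * (2 * (1 + Real.log x))) := by
            gcongr
            · exact sum_gcd_mul_reciprocalWeight_le hx hqx
            · exact sum_reciprocalWeight_le hx hqx
        _ = _ := by ring

lemma sum_card_divisors_le {n : ℕ} {x : ℝ} (hx : 1 ≤ x) (hn : n ≤ x) :
    ∑ q ∈ Ioc 0 n, (#q.divisors : ℝ) ≤ x * (1 + Real.log x) := by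
  have h := ArithmeticFunction.sum_Ioc_sigma0_eq_sum_div n
  simp only [ArithmeticFunction.sigma_zero_apply] at h
  have h' : ∑ q ∈ Ioc 0 n, (#q.divisors : ℝ) = ∑ d ∈ Ioc 0 n, ((n / d : ℕ) : ℝ) := by
    exact_mod_cast h
  rw [h']
  calc ∑ d ∈ Ioc 0 n, ((n / d : ℕ) : ℝ) ≤ ∑ d ∈ Icc 1 n, x * (d : ℝ)⁻¹ := by
        rw [← Icc_add_one_left_eq_Ioc, zero_add]
        refine sum_le_sum fun d _ => Nat.cast_div_le.trans ?_
        rw [div_eq_mul_inv]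
        gcongr
    _ ≤ _ := by
        rw [← mul_sum]
        gcongr
        exact sum_inv_le_one_add_log hx hn

lemma floor_two_mul_sub_floor_le {x : ℝ} (hx : 2 ≤ x) :
    ((⌊2 * x⌋₊ - ⌊x⌋₊ : ℕ) : ℝ) ≤ 2 * x := by
  refine le_trans ?_ (Nat.floor_le (by linarith))
  exact_mod_cast Nat.sub_le _ _

/-- Triple `ψ`-sum estimate: there is an absolute constant `C > 0` such that for all reals
`2 ≤ H₁ ≤ H₂` and `N₂ ≥ 2` and all reals `c(h₁, h₂)` depending only on `h₁, h₂`,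
`|Σ_{H₁ < h₁ ≤ 2H₁} Σ_{H₂ < h₂ ≤ 2H₂} Σ_{N₂ < n₂ ≤ 2N₂} ψ(h₂n₂/h₁ + c(h₁,h₂))|
  ≤ C·(H₂N₂ + H₁H₂)·log²(2H₁)`. -/
theorem triple_psi_sum :
    ∃ C : ℝ, 0 < C ∧ ∀ H₁ H₂ N₂ : ℝ, 2 ≤ H₁ → H₁ ≤ H₂ → 2 ≤ N₂ →
      ∀ c : ℕ → ℕ → ℝ,
        |∑ h₁ ∈ Finset.Ioc ⌊H₁⌋₊ ⌊2 * H₁⌋₊, ∑ h₂ ∈ Finset.Ioc ⌊H₂⌋₊ ⌊2 * H₂⌋₊,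
            ∑ n₂ ∈ Finset.Ioc ⌊N₂⌋₊ ⌊2 * N₂⌋₊,
              psi (((h₂ : ℝ) * n₂) / h₁ + c h₁ h₂)| ≤
          C * (H₂ * N₂ + H₁ * H₂) * Real.log (2 * H₁) ^ 2 := by
  refine ⟨128, by norm_num, fun H₁ H₂ N₂ hH₁ hH₂ hN₂ c => ?_⟩
  set x := 2 * H₁ with hx
  set L := Real.log x with hL
  have hx1 : 1 ≤ x := by linarith
  have hL1 : 1 ≤ L := by
    rw [hL, Real.le_log_iff_exp_le (by linarith)]
    linarith [Real.exp_one_lt_d9]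
  have hL0 : 0 < L := by linarith
  have hx0 : 0 < x := by linarith
  have hH₁0 : 0 < H₁ := by linarith
  have hH₂0 : 0 < H₂ := by linarith
  have hN₂0 : 0 < N₂ := by linarith
  have hM := floor_two_mul_sub_floor_le hN₂
  have hK := floor_two_mul_sub_floor_le (hH₁.trans hH₂)
  have hfl : (⌊x⌋₊ : ℝ) ≤ x := Nat.floor_le (by linarith)
  have hbound : ∀ q ∈ Ioc ⌊H₁⌋₊ ⌊x⌋₊,
      |∑ h₂ ∈ Ioc ⌊H₂⌋₊ ⌊2 * H₂⌋₊, ∑ n₂ ∈ Ioc ⌊N₂⌋₊ ⌊2 * N₂⌋₊,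
        psi (((h₂ : ℝ) * n₂) / q + c q h₂)| ≤
      16 * (H₂ / H₁) * N₂ * L * #q.divisors + 8 * H₂ * L ^ 2 := by
    intro q hq
    obtain ⟨hq1, hq2⟩ := mem_Ioc.1 hq
    have hq0 : 0 < q := by omega
    have hqR : (0 : ℝ) < q := by exact_mod_cast hq0
    have hqx : (q : ℝ) ≤ x := le_trans (by exact_mod_cast hq2) hfl
    have hHq : H₁ ≤ q := ((Nat.floor_lt (by linarith)).1 hq1).le
    have hτ : (1 : ℝ) ≤ #q.divisors := by
      exact_mod_cast card_pos.2 ⟨1, Nat.one_mem_divisors.2 hq0.ne'⟩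
    refine (abs_sum_le_sum_abs _ _).trans
      ((sum_sum_abs_psi_le hq0 _ _ _ _ (c q) hx1 hqx).trans ?_)
    rw [← hL]
    set M : ℝ := ((⌊2 * N₂⌋₊ - ⌊N₂⌋₊ : ℕ) : ℝ)
    set K : ℝ := ((⌊2 * H₂⌋₊ - ⌊H₂⌋₊ : ℕ) : ℝ)
    set τ : ℝ := (#q.divisors : ℝ)
    have hM0 : 0 ≤ M := Nat.cast_nonneg _
    have hτL : 1 ≤ τ * L := one_le_mul_of_one_le_of_one_le hτ hL1
    calc (K / q + 1) * (M + (τ * (1 + L) * M + q * (1 + L) ^ 2) / 2)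
        ≤ (4 * H₂ / q) * (2 * (τ * L) * (2 * N₂) + q * (2 * L) ^ 2 / 2) := by
          have h1 : K / q + 1 ≤ 4 * H₂ / q := by
            rw [div_add_one hqR.ne']
            gcongr
            linarith
          have h2 : τ * (1 + L) * M ≤ 2 * (τ * L) * M := by
            rw [show 2 * (τ * L) = τ * (L + L) by ring]
            gcongr
          have h3 : M ≤ τ * L * M := le_mul_of_one_le_left hM0 hτL
          have h4 : τ * L * M ≤ τ * L * (2 * N₂) := by gcongr
          have h5 : (q : ℝ) * (1 + L) ^ 2 ≤ q * (2 * L) ^ 2 := by gcongr; linarith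
          refine mul_le_mul h1 (by linarith) (by positivity) (by positivity)
      _ = 16 * (H₂ / q) * N₂ * L * τ + 8 * H₂ * L ^ 2 := by
          field_simp
          ring
      _ ≤ _ := by
          gcongr
  refine (abs_sum_le_sum_abs _ _).trans ((sum_le_sum hbound).trans ?_)
  rw [sum_add_distrib, ← mul_sum, sum_const, nsmul_eq_mul, Nat.card_Ioc]
  have hdiv : ∑ q ∈ Ioc ⌊H₁⌋₊ ⌊x⌋₊, (#q.divisors : ℝ) ≤ x * (2 * L) := by
    refine (sum_le_sum_of_subset_of_nonneg (Ioc_subset_Ioc_left (Nat.zero_le _))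
      fun _ _ _ => Nat.cast_nonneg _).trans ((sum_card_divisors_le hx1 hfl).trans ?_)
    gcongr
    linarith
  calc 16 * (H₂ / H₁) * N₂ * L * ∑ q ∈ Ioc ⌊H₁⌋₊ ⌊x⌋₊, (#q.divisors : ℝ) +
        ((⌊x⌋₊ - ⌊H₁⌋₊ : ℕ) : ℝ) * (8 * H₂ * L ^ 2)
      ≤ 16 * (H₂ / H₁) * N₂ * L * (x * (2 * L)) + x * (8 * H₂ * L ^ 2) := by
        gcongr
        exact floor_two_mul_sub_floor_le hH₁
    _ = (64 * (H₂ * N₂) + 16 * (H₁ * H₂)) * L ^ 2 := by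
        rw [hx]
        field_simp
        ring
    _ ≤ _ := by
        have h1 : 0 < H₁ * H₂ := by positivity
        have h2 : 0 < H₂ * N₂ := by positivity
        gcongr
        linarith
end

section
/- (Convergence and positivity of the constant C_{l,θ}) For every integer l ≥ 1 and every real θ > 0, the double series Σ_{h=1}^∞ Σ_{r ∈ ℕ, r > θh} (1 − θh/(2r − θh))^{2l−2} · h^{−1/2} · (2r − θh)^{−5/2} converges to a finite positive real number C_{l,θ}. -/
open Classical in
/-- The general term of the double series defining `C_{l,θ}`: for `h = p.1`, `r = p.2`
positive integers with `r > θh` it equals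
`(1 − θh/(2r − θh))^{2l−2} · h^{−1/2} · (2r − θh)^{−5/2}`, and otherwise `0`. -/
noncomputable def cTerm (l : ℕ) (θ : ℝ) (p : ℕ × ℕ) : ℝ :=
  if 1 ≤ p.1 ∧ 1 ≤ p.2 ∧ θ * p.1 < (p.2 : ℝ) then
    (1 - θ * p.1 / (2 * p.2 - θ * p.1)) ^ (2 * l - 2) *
      (p.1 : ℝ) ^ (-(1 : ℝ) / 2) * (2 * (p.2 : ℝ) - θ * p.1) ^ (-(5 : ℝ) / 2)
  else 0

/-- For `x, y > 0` with `x < y`, one has `0 < 1 - x / (2 * y - x)`. -/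
theorem one_sub_div_two_mul_sub_pos {x y : ℝ} (hx : 0 < x) (hxy : x < y) :
    0 < 1 - x / (2 * y - x) := by
  rw [sub_pos, div_lt_one (by linarith)]
  linarith

theorem cTerm_pos {l : ℕ} {θ : ℝ} (hθ : 0 < θ) {p : ℕ × ℕ} (hp₁ : 1 ≤ p.1)
    (hp : θ * p.1 < (p.2 : ℝ)) : 0 < cTerm l θ p := by
  have hh : (0 : ℝ) < p.1 := by exact_mod_cast hp₁
  have hx : 0 < θ * p.1 := by positivity
  have hp₂ : 1 ≤ p.2 := by
    have : (0 : ℝ) < p.2 := hx.trans hp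
    exact_mod_cast this
  have hbase := one_sub_div_two_mul_sub_pos hx hp
  have hden : 0 < 2 * (p.2 : ℝ) - θ * p.1 := by linarith
  rw [cTerm, if_pos ⟨hp₁, hp₂, hp⟩]
  positivity

theorem cTerm_nonneg (l : ℕ) {θ : ℝ} (hθ : 0 < θ) (p : ℕ × ℕ) : 0 ≤ cTerm l θ p := by
  by_cases h : 1 ≤ p.1 ∧ 1 ≤ p.2 ∧ θ * p.1 < (p.2 : ℝ)
  · exact (cTerm_pos hθ h.1 h.2.2).le
  · rw [cTerm, if_neg h]

/-- If `a` dominates both `x` and `y`, then `a ^ (-5/2) ≤ x⁻¹ * y ^ (-3/2)`. -/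
theorem rpow_neg_five_halves_le {a x y : ℝ} (hx : 0 < x) (hy : 0 < y) (hxa : x ≤ a)
    (hya : y ≤ a) : a ^ (-(5 : ℝ) / 2) ≤ x⁻¹ * y ^ (-(3 : ℝ) / 2) := by
  have ha : 0 < a := hx.trans_le hxa
  have hsplit : a ^ (-(5 : ℝ) / 2) = a⁻¹ * a ^ (-(3 : ℝ) / 2) := by
    rw [← Real.rpow_neg_one, ← Real.rpow_add ha]
    norm_num
  rw [hsplit]
  exact mul_le_mul (inv_anti₀ hx hxa)
    (Real.rpow_le_rpow_of_nonpos hy hya (by norm_num)) (by positivity) (by positivity)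

theorem cTerm_le (l : ℕ) {θ : ℝ} (hθ : 0 < θ) (p : ℕ × ℕ) :
    cTerm l θ p ≤ θ⁻¹ * ((p.1 : ℝ) ^ (-(3 : ℝ) / 2) * (p.2 : ℝ) ^ (-(3 : ℝ) / 2)) := by
  by_cases h : 1 ≤ p.1 ∧ 1 ≤ p.2 ∧ θ * p.1 < (p.2 : ℝ)
  · have hh : (0 : ℝ) < p.1 := by exact_mod_cast h.1
    have hr : (0 : ℝ) < p.2 := by exact_mod_cast h.2.1
    have hx : 0 < θ * p.1 := by positivity
    have hden : 0 < 2 * (p.2 : ℝ) - θ * p.1 := by linarith [h.2.2]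
    have hpow : (1 - θ * p.1 / (2 * p.2 - θ * p.1)) ^ (2 * l - 2) ≤ 1 :=
      pow_le_one₀ (one_sub_div_two_mul_sub_pos hx h.2.2).le
        (sub_le_self _ (by positivity))
    have hsplit : (p.1 : ℝ) ^ (-(3 : ℝ) / 2) = (p.1 : ℝ) ^ (-(1 : ℝ) / 2) * (p.1 : ℝ)⁻¹ := by
      rw [← Real.rpow_neg_one, ← Real.rpow_add hh]
      norm_num
    rw [cTerm, if_pos h]
    calc _ ≤ 1 * (p.1 : ℝ) ^ (-(1 : ℝ) / 2) * ((θ * p.1)⁻¹ * (p.2 : ℝ) ^ (-(3 : ℝ) / 2)) := by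
          gcongr
          exact rpow_neg_five_halves_le hx hr (by linarith [h.2.2]) (by linarith [h.2.2])
      _ = _ := by
          rw [hsplit, mul_inv]
          ring
  · rw [cTerm, if_neg h]
    positivity

theorem summable_cTerm (l : ℕ) {θ : ℝ} (hθ : 0 < θ) : Summable (cTerm l θ) := by
  have hs : Summable fun n : ℕ => (n : ℝ) ^ (-(3 : ℝ) / 2) :=
    Real.summable_nat_rpow.2 (by norm_num)
  have hn : 0 ≤ fun n : ℕ => (n : ℝ) ^ (-(3 : ℝ) / 2) := fun n => by positivity
  exact Summable.of_nonneg_of_le (cTerm_nonneg l hθ) (cTerm_le l hθ)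
    ((hs.mul_of_nonneg hs hn hn).mul_left θ⁻¹)

/-- Convergence and positivity of the constant `C_{l,θ}`: for every integer `l ≥ 1` and real
`θ > 0`, the double series
`Σ_{h=1}^∞ Σ_{r > θh} (1 − θh/(2r − θh))^{2l−2} · h^{−1/2} · (2r − θh)^{−5/2}`
converges to a finite positive real number. -/
theorem C_l_theta_convergent_positive (l : ℕ) (hl : 1 ≤ l) (θ : ℝ) (hθ : 0 < θ) :
    Summable (cTerm l θ) ∧ 0 < ∑' p : ℕ × ℕ, cTerm l θ p := by
  obtain ⟨r, hr⟩ := exists_nat_gt θ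
  have hs := summable_cTerm l hθ
  exact ⟨hs, hs.tsum_pos (cTerm_nonneg l hθ) (1, r) (cTerm_pos hθ le_rfl (by simpa using hr))⟩
end

section
/- (Mean value of G(x,H), estimate (5.27)) For every real θ > 0 and integer l ≥ 1 there exists a constant C = C(θ) > 0 such that for all reals T ≥ 2 and H ≥ 2: ∫_T^{2T} Σ_{1 ≤ m ≤ √(2T/θ)} min(1, 1/(H·‖x/(2m) − θm/2 + l/2‖)) dx ≤ C·T^{3/2}·H^{−1}·log H, where for x such that x/(2m) − θm/2 + l/2 is an integer the summand is interpreted as 1. -/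
open Finset

open Classical in
/-- The summand `min(1, 1/(H‖t‖))`, interpreted as `1` when `t` is an integer
(i.e. when `‖t‖ = 0`). -/
noncomputable def minTerm (H t : ℝ) : ℝ :=
  if dnint t = 0 then 1 else min 1 (1 / (H * dnint t))

open MeasureTheory intervalIntegral

lemma dnint_eq_norm (t : ℝ) : dnint t = ‖(t : UnitAddCircle)‖ := by
  rw [UnitAddCircle.norm_eq, dnint]

lemma dnint_nonneg (t : ℝ) : 0 ≤ dnint t := abs_nonneg _

lemma dnint_neg (t : ℝ) : dnint (-t) = dnint t := by
  simp [dnint_eq_norm]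

lemma dnint_add_one (t : ℝ) : dnint (t + 1) = dnint t := by
  simp [dnint, round_add_one]

lemma dnint_of_mem_Icc {t : ℝ} (h0 : 0 ≤ t) (h1 : t ≤ 1 / 2) : dnint t = t := by
  rw [dnint, abs_sub_round_eq_min, Int.fract_eq_self.2 ⟨h0, by linarith⟩]
  exact min_eq_left (by linarith)

lemma measurable_dnint : Measurable dnint := by
  have h : dnint = fun t : ℝ => min (Int.fract t) (1 - Int.fract t) := by
    ext t
    rw [dnint, abs_sub_round_eq_min]
  rw [h]
  fun_prop

lemma minTerm_nonneg {H : ℝ} (hH : 0 ≤ H) (t : ℝ) : 0 ≤ minTerm H t := by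
  have := dnint_nonneg t
  unfold minTerm
  split_ifs <;> positivity

lemma minTerm_le_one (H t : ℝ) : minTerm H t ≤ 1 := by
  unfold minTerm
  split_ifs
  · exact le_rfl
  · exact min_le_left _ _

lemma minTerm_neg (H t : ℝ) : minTerm H (-t) = minTerm H t := by
  simp only [minTerm, dnint_neg]

lemma minTerm_periodic (H : ℝ) : Function.Periodic (minTerm H) 1 := fun t => by
  simp only [minTerm, dnint_add_one]

lemma minTerm_le_of_mem_Icc (H : ℝ) {t : ℝ} (h0 : 0 < t) (h1 : t ≤ 1 / 2) :
    minTerm H t ≤ H⁻¹ * t⁻¹ := by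
  rw [minTerm, dnint_of_mem_Icc h0.le h1, if_neg h0.ne', ← mul_inv, ← one_div]
  exact min_le_right _ _

lemma measurable_minTerm (H : ℝ) : Measurable (minTerm H) := by
  unfold minTerm
  refine Measurable.ite (measurable_dnint (measurableSet_singleton 0)) measurable_const ?_
  exact measurable_const.min (measurable_const.div (measurable_const.mul measurable_dnint))

lemma intervalIntegrable_minTerm_comp {H : ℝ} (hH : 0 ≤ H) {g : ℝ → ℝ} (hg : Measurable g)
    (a b : ℝ) : IntervalIntegrable (fun x => minTerm H (g x)) volume a b := by
  refine (intervalIntegrable_const (c := (1 : ℝ))).mono_fun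
    ((measurable_minTerm H).comp hg).aestronglyMeasurable (Filter.Eventually.of_forall fun x => ?_)
  simpa [abs_of_nonneg (minTerm_nonneg hH (g x))] using minTerm_le_one H (g x)

lemma intervalIntegrable_minTerm {H : ℝ} (hH : 0 ≤ H) (a b : ℝ) :
    IntervalIntegrable (minTerm H) volume a b :=
  intervalIntegrable_minTerm_comp hH measurable_id a b

lemma integral_minTerm_half_le {H : ℝ} (hH : 2 ≤ H) :
    ∫ u in (0 : ℝ)..(1 / 2), minTerm H u ≤ 3 * (H⁻¹ * Real.log H) := by
  have hH0 : 0 < H := by linarith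
  have hi : 0 < H⁻¹ := by positivity
  have hi2 : H⁻¹ ≤ 1 / 2 := by
    rw [one_div]
    exact inv_anti₀ (by norm_num) hH
  have hint := intervalIntegrable_minTerm hH0.le
  rw [← integral_add_adjacent_intervals (hint 0 H⁻¹) (hint H⁻¹ (1 / 2))]
  have h1 : ∫ u in (0 : ℝ)..H⁻¹, minTerm H u ≤ H⁻¹ := by
    have := integral_mono_on hi.le (hint 0 H⁻¹) (intervalIntegrable_const (c := (1 : ℝ)))
      fun x _ => minTerm_le_one H x
    simpa using this
  have h0 : (0 : ℝ) ∉ Set.uIcc H⁻¹ (1 / 2) := by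
    rw [Set.uIcc_of_le hi2]
    exact fun h => absurd h.1 (not_le.2 hi)
  have h2 : ∫ u in H⁻¹..(1 / 2), minTerm H u ≤ H⁻¹ * Real.log H := by
    have hinv : IntervalIntegrable (fun x : ℝ => H⁻¹ * x⁻¹) volume H⁻¹ (1 / 2) :=
      (intervalIntegral.intervalIntegrable_inv (fun x hx h => h0 (h ▸ hx))
        continuousOn_id).const_mul _
    have := integral_mono_on hi2 (hint H⁻¹ (1 / 2)) hinv
      fun x hx => minTerm_le_of_mem_Icc H (hi.trans_le hx.1) hx.2
    rw [intervalIntegral.integral_const_mul, integral_inv h0] at this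
    refine this.trans (mul_le_mul_of_nonneg_left (Real.log_le_log (by positivity) ?_) hi.le)
    rw [div_inv_eq_mul]
    linarith
  have hlog : 1 / 2 ≤ Real.log H :=
    (by linarith [Real.log_two_gt_d9] : 1 / 2 ≤ Real.log 2).trans
      (Real.log_le_log (by norm_num) hH)
  nlinarith

lemma integral_minTerm_period_le {H : ℝ} (hH : 2 ≤ H) (a : ℝ) :
    ∫ u in a..(a + 1), minTerm H u ≤ 6 * (H⁻¹ * Real.log H) := by
  have hint := intervalIntegrable_minTerm (by linarith : 0 ≤ H)
  rw [(minTerm_periodic H).intervalIntegral_add_eq a (-(1 / 2))]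
  have hsymm : ∫ u in (-(1 / 2) : ℝ)..0, minTerm H u = ∫ u in (0 : ℝ)..(1 / 2), minTerm H u := by
    have := integral_comp_neg (a := 0) (b := 1 / 2) (minTerm H)
    simp only [minTerm_neg, neg_zero] at this
    exact this.symm
  rw [show (-(1 / 2) + 1 : ℝ) = 1 / 2 by norm_num,
    ← integral_add_adjacent_intervals (hint (-(1 / 2)) 0) (hint 0 (1 / 2)),
    hsymm]
  linarith [integral_minTerm_half_le hH]

lemma integral_minTerm_le {H : ℝ} (hH : 2 ≤ H) {a b : ℝ} (hab : a ≤ b) :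
    ∫ u in a..b, minTerm H u ≤ (b - a + 1) * (6 * (H⁻¹ * Real.log H)) := by
  have hH0 : 0 ≤ H := by linarith
  have hlog : 0 ≤ Real.log H := Real.log_nonneg (by linarith)
  have hint := intervalIntegrable_minTerm hH0
  have hn : b - a ≤ ⌈b - a⌉₊ := Nat.le_ceil _
  calc ∫ u in a..b, minTerm H u
      ≤ ∫ u in a..(a + (⌈b - a⌉₊ : ℤ) • (1 : ℝ)), minTerm H u := by
        refine integral_mono_interval le_rfl hab ?_
          (Filter.Eventually.of_forall fun u => minTerm_nonneg hH0 u) (hint _ _)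
        simp only [zsmul_eq_mul, Int.cast_natCast, mul_one]
        linarith
    _ = ⌈b - a⌉₊ * ∫ u in a..(a + 1), minTerm H u := by
        rw [(minTerm_periodic H).intervalIntegral_add_zsmul_eq _ _ fun _ _ => hint _ _]
        simp
    _ ≤ ⌈b - a⌉₊ * (6 * (H⁻¹ * Real.log H)) := by
        gcongr
        exact integral_minTerm_period_le hH a
    _ ≤ (b - a + 1) * (6 * (H⁻¹ * Real.log H)) := by
        gcongr
        exact (Nat.ceil_lt_add_one (by linarith)).le

lemma integral_minTerm_comp_div_add_le {H : ℝ} (hH : 2 ≤ H) {a b c : ℝ} (hab : a ≤ b)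
    (hc : 0 < c) (d : ℝ) :
    ∫ x in a..b, minTerm H (x / c + d) ≤ (b - a + c) * (6 * (H⁻¹ * Real.log H)) := by
  rw [integral_comp_div_add _ hc.ne', smul_eq_mul]
  have hle : a / c + d ≤ b / c + d := by gcongr
  refine (mul_le_mul_of_nonneg_left (integral_minTerm_le hH hle) hc.le).trans_eq ?_
  field_simp
  ring

/-- Mean value of `G(x,H)`, estimate (5.27): for every real `θ > 0` and integer `l ≥ 1`
there is `C = C(θ) > 0` such that for all reals `T ≥ 2` and `H ≥ 2`,
`∫_T^{2T} Σ_{1 ≤ m ≤ √(2T/θ)} min(1, 1/(H‖x/(2m) − θm/2 + l/2‖)) dx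
  ≤ C·T^{3/2}·H^{−1}·log H`. -/
theorem G_mean_value (θ : ℝ) (hθ : 0 < θ) (l : ℕ) (hl : 1 ≤ l) :
    ∃ C : ℝ, 0 < C ∧ ∀ T H : ℝ, 2 ≤ T → 2 ≤ H →
      (∫ x in T..(2 * T),
          ∑ m ∈ Finset.Icc 1 ⌊Real.sqrt (2 * T / θ)⌋₊,
            minTerm H (x / (2 * m) - θ * m / 2 + l / 2)) ≤
        C * T ^ ((3 : ℝ) / 2) * H⁻¹ * Real.log H := by
  refine ⟨6 * √(2 / θ) * (1 + 2 * √(2 / θ)), by positivity, fun T H hT hH => ?_⟩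
  have hT0 : 0 < T := by linarith
  have hlog : 0 ≤ Real.log H := Real.log_nonneg (by linarith)
  set k := √(2 / θ) with hk
  have hk0 : 0 ≤ k := Real.sqrt_nonneg _
  have hsqrt : √(2 * T / θ) = k * √T := by
    rw [hk, ← Real.sqrt_mul (by positivity)]
    ring_nf
  have hpow : T ^ ((3 : ℝ) / 2) = √T * T := by
    rw [Real.sqrt_eq_rpow, ← Real.rpow_add_one hT0.ne']
    norm_num
  have hsT : √T ≤ T := (Real.sqrt_le_left hT0.le).2 (by nlinarith)
  rw [intervalIntegral.integral_finsetSum fun m _ =>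
    intervalIntegrable_minTerm_comp (by linarith) (by fun_prop) _ _]
  have hM : (⌊√(2 * T / θ)⌋₊ : ℝ) ≤ k * √T :=
    hsqrt ▸ Nat.floor_le (Real.sqrt_nonneg _)
  have hterm : ∀ m ∈ Icc 1 ⌊√(2 * T / θ)⌋₊,
      ∫ x in T..(2 * T), minTerm H (x / (2 * m) - θ * m / 2 + l / 2) ≤
        T * (1 + 2 * k) * (6 * (H⁻¹ * Real.log H)) := by
    intro m hm
    rw [Finset.mem_Icc] at hm
    have hm0 : (0 : ℝ) < 2 * m := by
      have : 0 < m := hm.1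
      positivity
    have hmM : (m : ℝ) ≤ k * T :=
      ((Nat.cast_le.2 hm.2).trans hM).trans (mul_le_mul_of_nonneg_left hsT hk0)
    simp only [sub_eq_add_neg, add_assoc]
    refine (integral_minTerm_comp_div_add_le hH (by linarith) hm0 _).trans ?_
    gcongr
    linarith
  calc _ ≤ _ := Finset.sum_le_card_nsmul _ _ _ hterm
    _ = ⌊√(2 * T / θ)⌋₊ * (T * (1 + 2 * k) * (6 * (H⁻¹ * Real.log H))) := by simp
    _ ≤ k * √T * (T * (1 + 2 * k) * (6 * (H⁻¹ * Real.log H))) := by gcongr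
    _ = _ := by
      rw [hpow]
      ring
end

section
/- (Estimate (5.7), bound for the sum defining g(T,H)) For every real γ ≥ 1 and every ε ∈ (0, 1/10) there exists a constant C = C(γ, ε) > 0 such that for all reals T ≥ 3 and all integers J ≥ 0: Σ_{1 ≤ h ≤ T²} (1/h) · Σ_{j=0}^{J} min( T^{1/4}·h^{−1/2}·2^{−3j/2}, (h·2^{2j})^{γ+ε} ) ≤ C·T^{γ/(4γ+2) + ε}. -/
open Finset

lemma min_le_rpow_mul_rpow {x y θ : ℝ} (hx : 0 < x) (hy : 0 < y) (h0 : 0 ≤ θ) (h1 : θ ≤ 1) :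
    min x y ≤ x ^ θ * y ^ (1 - θ) := by
  have hm : 0 < min x y := lt_min hx hy
  calc min x y = min x y ^ θ * min x y ^ (1 - θ) := by
        rw [← Real.rpow_add hm, add_sub_cancel, Real.rpow_one]
    _ ≤ x ^ θ * y ^ (1 - θ) :=
        mul_le_mul (Real.rpow_le_rpow hm.le (min_le_left x y) h0)
          (Real.rpow_le_rpow hm.le (min_le_right x y) (sub_nonneg.2 h1))
          (Real.rpow_nonneg hm.le _) (Real.rpow_nonneg hx.le _)

/-- Interpolating between the two terms of the minimum so that the dependence on `h` cancels. -/
lemma min_le_rpow_mul_geometric {a T h : ℝ} (ha : 0 < a) (hT : 0 < T) (hh : 0 < h) (j : ℕ) :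
    min (T ^ ((1 : ℝ) / 4) * h ^ (-(1 : ℝ) / 2) * (2 : ℝ) ^ (-(3 * (j : ℝ)) / 2))
        ((h * 2 ^ (2 * j)) ^ a) ≤
      T ^ (a / (4 * a + 2)) * ((2 : ℝ) ^ (-(a / (2 * a + 1)))) ^ j := by
  have hb : 2 * (a / (2 * a + 1)) ≤ 1 := by
    rw [← mul_div_assoc, div_le_one (by positivity)]
    linarith
  refine (min_le_rpow_mul_rpow (by positivity) (by positivity)
    (by positivity : 0 ≤ 2 * (a / (2 * a + 1))) hb).trans_eq ?_
  have hcomp : a * (1 - 2 * (a / (2 * a + 1))) = a / (2 * a + 1) := by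
    field_simp
    ring
  have hhalf : a / (4 * a + 2) = 1 / 4 * (2 * (a / (2 * a + 1))) := by
    field_simp
    ring
  rw [← Real.rpow_mul (by positivity), hcomp, hhalf]
  generalize a / (2 * a + 1) = b
  have hpow : (2 : ℝ) ^ (2 * j) = (2 : ℝ) ^ (2 * (j : ℝ)) := by
    rw [← Real.rpow_natCast]
    push_cast
    rfl
  rw [hpow, Real.mul_rpow (by positivity) (by positivity),
    Real.mul_rpow (by positivity) (by positivity),
    Real.mul_rpow (by positivity) (by positivity), ← Real.rpow_natCast,
    ← Real.rpow_mul hT.le, ← Real.rpow_mul hh.le, ← Real.rpow_mul zero_le_two,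
    ← Real.rpow_mul zero_le_two, ← Real.rpow_mul zero_le_two]
  have hcancel : h ^ (-(1 : ℝ) / 2 * (2 * b)) * h ^ b = 1 := by
    rw [← Real.rpow_add hh]
    ring_nf
    exact Real.rpow_zero h
  have htwo : (2 : ℝ) ^ (-(3 * (j : ℝ)) / 2 * (2 * b)) * (2 : ℝ) ^ (2 * (j : ℝ) * b) =
      (2 : ℝ) ^ (-b * (j : ℝ)) := by
    rw [← Real.rpow_add zero_lt_two]
    ring_nf
  rw [← htwo]
  linear_combination T ^ (1 / 4 * (2 * b)) * (2 : ℝ) ^ (-(3 * (j : ℝ)) / 2 * (2 * b)) *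
    (2 : ℝ) ^ (2 * (j : ℝ) * b) * hcancel

lemma sum_Icc_one_div_le_rpow {δ T : ℝ} (hδ : 0 < δ) (hT : 1 ≤ T) :
    ∑ h ∈ Finset.Icc 1 ⌊T ^ 2⌋₊, 1 / (h : ℝ) ≤ (1 + 2 / δ) * T ^ δ := by
  have hharm := harmonic_floor_le_one_add_log (T ^ 2) (one_le_pow₀ hT)
  rw [harmonic_eq_sum_Icc] at hharm
  push_cast at hharm
  simp only [one_div]
  have hlog := Real.log_le_rpow_div (zero_le_one.trans hT) hδ
  have hone := Real.one_le_rpow hT hδ.le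
  have hlog2 : Real.log (T ^ 2) = 2 * Real.log T := by
    rw [Real.log_pow]
    norm_num
  calc _ ≤ 1 + Real.log (T ^ 2) := hharm
    _ ≤ T ^ δ + 2 * (T ^ δ / δ) := by
        rw [hlog2]
        linarith
    _ = (1 + 2 / δ) * T ^ δ := by ring

lemma div_four_mul_add_two_add_le {γ ε : ℝ} (hγ : 0 ≤ γ) (hε : 0 ≤ ε) :
    (γ + ε) / (4 * (γ + ε) + 2) ≤ γ / (4 * γ + 2) + ε / 2 := by
  rw [div_add_div _ _ (by positivity) two_ne_zero, div_le_div_iff₀ (by positivity) (by positivity)]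
  nlinarith [mul_nonneg hε hε, mul_nonneg hγ hε, mul_nonneg (mul_nonneg hγ hε) hε,
    mul_nonneg (mul_nonneg hγ hε) hγ]

/-- Estimate (5.7) (bound for the sum defining `g(T,H)`): for every real `γ ≥ 1` and
`ε ∈ (0, 1/10)` there is `C = C(γ, ε) > 0` such that for all reals `T ≥ 3` and all
integers `J ≥ 0`,
`Σ_{1 ≤ h ≤ T²} (1/h) · Σ_{j=0}^{J} min(T^{1/4}·h^{−1/2}·2^{−3j/2}, (h·2^{2j})^{γ+ε})
  ≤ C·T^{γ/(4γ+2)+ε}`. -/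
theorem g_TH_bound (γ : ℝ) (hγ : 1 ≤ γ) (ε : ℝ) (hε : 0 < ε) (hε' : ε < 1 / 10) :
    ∃ C : ℝ, 0 < C ∧ ∀ T : ℝ, 3 ≤ T → ∀ J : ℕ,
      ∑ h ∈ Finset.Icc 1 ⌊T ^ 2⌋₊, (1 / (h : ℝ)) *
          ∑ j ∈ Finset.range (J + 1),
            min (T ^ ((1 : ℝ) / 4) * (h : ℝ) ^ (-(1 : ℝ) / 2) * (2 : ℝ) ^ (-(3 * (j : ℝ)) / 2))
              (((h : ℝ) * 2 ^ (2 * j)) ^ (γ + ε)) ≤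
        C * T ^ (γ / (4 * γ + 2) + ε) := by
  have ha : 0 < γ + ε := by linarith
  set r : ℝ := (2 : ℝ) ^ (-((γ + ε) / (2 * (γ + ε) + 1)))
  have hr0 : 0 < r := by positivity
  have hr1 : r < 1 := Real.rpow_lt_one_of_one_lt_of_neg one_lt_two
    (neg_lt_zero.2 (by positivity))
  have hG : 0 < (1 - r)⁻¹ := inv_pos.2 (sub_pos.2 hr1)
  refine ⟨(1 - r)⁻¹ * (1 + 2 / (ε / 2)), by positivity, fun T hT J ↦ ?_⟩
  have hT0 : 0 < T := by linarith
  have hT1 : 1 ≤ T := by linarith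
  have hgeom : ∑ j ∈ Finset.range (J + 1), r ^ j ≤ (1 - r)⁻¹ := by
    rw [← tsum_geometric_of_lt_one hr0.le hr1]
    exact (summable_geometric_of_lt_one hr0.le hr1).sum_le_tsum _ fun _ _ ↦ by positivity
  set S : ℝ := T ^ ((γ + ε) / (4 * (γ + ε) + 2))
  have hS0 : 0 < S := by positivity
  calc _ ≤ ∑ h ∈ Finset.Icc 1 ⌊T ^ 2⌋₊, (1 / (h : ℝ)) * (S * (1 - r)⁻¹) := by
        refine Finset.sum_le_sum fun h hh ↦ mul_le_mul_of_nonneg_left ?_ (by positivity)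
        have hh0 : (0 : ℝ) < h := Nat.cast_pos.2 (Finset.mem_Icc.1 hh).1
        refine (Finset.sum_le_sum fun j _ ↦ min_le_rpow_mul_geometric ha hT0 hh0 j).trans ?_
        rw [← Finset.mul_sum]
        exact mul_le_mul_of_nonneg_left hgeom hS0.le
    _ ≤ (1 + 2 / (ε / 2)) * T ^ (ε / 2) * (S * (1 - r)⁻¹) := by
        rw [← Finset.sum_mul]
        exact mul_le_mul_of_nonneg_right (sum_Icc_one_div_le_rpow (half_pos hε) hT1)
          (by positivity)
    _ = (1 - r)⁻¹ * (1 + 2 / (ε / 2)) * T ^ ((γ + ε) / (4 * (γ + ε) + 2) + ε / 2) := by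
        rw [Real.rpow_add hT0]
        ring
    _ ≤ _ := by
        refine mul_le_mul_of_nonneg_left (Real.rpow_le_rpow_of_exponent_le hT1 ?_) (by positivity)
        linarith [div_four_mul_add_two_add_le (zero_le_one.trans hγ) hε.le]
end
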